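/- Let n ∈ ℕ and for each i ∈ {1,…,n} let ψ_i(q) = q^{-τ_{ψ_i}} and φ_i(q) = q^{-τ_{φ_i}} with τ_{ψ_i}, τ_{φ_i} ∈ ℝ_{>0}, and assume Σ_{i=1}^n τ_{ψ_i} ≥ 1. Then dim_H W_n(Ψ,Φ) = max_{j=1,…,n} min_{k(j)=1,…,n} { (n + 1 + Σ_{i≠j : τ_{ψ_i} < τ_{k(j)}} (τ_{k(j)} - τ_{ψ_i}) + max{0, τ_{k(j)} - τ_{ψ_j} - τ_{φ_j}}) / (1 + τ_{k(j)}) }, where τ_{k(j)} = τ_{ψ_j} + τ_{φ_j} if k(j) = j, and τ_{k(j)} = τ_{ψ_{k(j)}} otherwise. -/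

import Mathlib

open MeasureTheory Filter Set

/-- The unit cube `[0,1]^n` in `ℝ^n` (with the maximum norm). -/
def unitCube (n : ℕ) : Set (Fin n → ℝ) := Set.univ.pi fun _ => Set.Icc (0 : ℝ) 1

/-- `W_n(Ψ, Φ)`: the set of `x ∈ [0,1]^n` such that, for infinitely many
`(p,q) ∈ ℤ^n × ℕ`, one has `|x_i - p_i/q| < ψ_i(q)/q` for every `i` and
`|x_j - p_j/q| > (1 - φ_j(q))·ψ_j(q)/q` for some `j`. -/
def Wweighted (n : ℕ) (Ψ Φ : Fin n → ℕ → ℝ) : Set (Fin n → ℝ) :=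
  {x ∈ unitCube n |
    {pq : (Fin n → ℤ) × ℕ | 0 < pq.2 ∧
      (∀ i, |x i - (pq.1 i : ℝ) / pq.2| < Ψ i pq.2 / pq.2) ∧
      (∃ j, (1 - Φ j pq.2) * (Ψ j pq.2 / pq.2) < |x j - (pq.1 j : ℝ) / pq.2|)}.Infinite}

/-- `τ_{k(j)}`: equals `τ_{ψ_j} + τ_{φ_j}` if `k = j`, and `τ_{ψ_k}` otherwise. -/
noncomputable def tauK {n : ℕ} (τψ τφ : Fin n → ℝ) (j k : Fin n) : ℝ :=
  if k = j then τψ j + τφ j else τψ k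

open scoped Classical in
/-- The quantity
`(n + 1 + Σ_{i ≠ j : τ_{ψ_i} < τ_{k(j)}}(τ_{k(j)} - τ_{ψ_i}) + max{0, τ_{k(j)} - τ_{ψ_j} - τ_{φ_j}}) / (1 + τ_{k(j)})`. -/
noncomputable def dimExpr (n : ℕ) (τψ τφ : Fin n → ℝ) (j k : Fin n) : ℝ :=
  ((n : ℝ) + 1 +
      (∑ i ∈ Finset.univ.filter fun i => i ≠ j ∧ τψ i < tauK τψ τφ j k,
        (tauK τψ τφ j k - τψ i)) +
      max 0 (tauK τψ τφ j k - τψ j - τφ j)) /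
    (1 + tauK τψ τφ j k)

/-! ### Dyadic cells and a Frostman-type lemma -/

/-- The half-open unit cube `[0,1)^n`. -/
def icoCube (n : ℕ) : Set (Fin n → ℝ) := Set.univ.pi fun _ => Set.Ico (0 : ℝ) 1

/-- The half-open dyadic cell of side `2^{-m}` with lower corner `z / 2^m`. -/
def dyadicCell {n : ℕ} (m : ℕ) (z : Fin n → ℕ) : Set (Fin n → ℝ) :=
  Set.univ.pi fun i => Set.Ico ((z i : ℝ) / 2 ^ m) (((z i : ℝ) + 1) / 2 ^ m)

/-- Indices of the dyadic cells of side `2^{-m}` that make up the unit cube. -/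
def dyadicIndex (n m : ℕ) : Finset (Fin n → ℕ) :=
  Fintype.piFinset fun _ => Finset.range (2 ^ m)

lemma measurableSet_icoCube (n : ℕ) : MeasurableSet (icoCube n) :=
  MeasurableSet.univ_pi fun _ => measurableSet_Ico

lemma measurableSet_dyadicCell {n : ℕ} (m : ℕ) (z : Fin n → ℕ) :
    MeasurableSet (dyadicCell m z) :=
  MeasurableSet.univ_pi fun _ => measurableSet_Ico

lemma mem_dyadicCell_iff {n m : ℕ} {z : Fin n → ℕ} {x : Fin n → ℝ} :
    x ∈ dyadicCell m z ↔ ∀ i, (z i : ℝ) ≤ 2 ^ m * x i ∧ 2 ^ m * x i < z i + 1 := by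
  have h2 : (0 : ℝ) < 2 ^ m := by positivity
  simp only [dyadicCell, Set.mem_univ_pi, Set.mem_Ico, div_le_iff₀ h2, lt_div_iff₀ h2,
    mul_comm (x _)]

lemma mem_dyadicIndex {n m : ℕ} {z : Fin n → ℕ} :
    z ∈ dyadicIndex n m ↔ ∀ i, z i < 2 ^ m := by
  simp [dyadicIndex]

lemma exists_mem_dyadicCell {n : ℕ} {x : Fin n → ℝ} (hx : x ∈ icoCube n) (m : ℕ) :
    ∃ z ∈ dyadicIndex n m, x ∈ dyadicCell m z := by
  have h2 : (0 : ℝ) < 2 ^ m := by positivity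
  have h0 : ∀ i, 0 ≤ 2 ^ m * x i := fun i => mul_nonneg h2.le (hx i trivial).1
  refine ⟨fun i => ⌊2 ^ m * x i⌋₊, mem_dyadicIndex.2 fun i => ?_, mem_dyadicCell_iff.2 fun i => ?_⟩
  · rw [Nat.floor_lt (h0 i)]
    have := (hx i trivial).2
    push_cast
    nlinarith
  · exact ⟨Nat.floor_le (h0 i), Nat.lt_floor_add_one _⟩

lemma dyadicCell_subset_icoCube {n m : ℕ} {z : Fin n → ℕ} (hz : z ∈ dyadicIndex n m) :
    dyadicCell m z ⊆ icoCube n := by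
  intro x hx i _
  have h2 : (0 : ℝ) < 2 ^ m := by positivity
  have h := mem_dyadicCell_iff.1 hx i
  have h1 : (z i : ℝ) + 1 ≤ 2 ^ m := by exact_mod_cast mem_dyadicIndex.1 hz i
  constructor
  · have := h.1.trans' (Nat.cast_nonneg (z i))
    exact nonneg_of_mul_nonneg_right this h2
  · by_contra! hc
    nlinarith [h.2]

lemma iUnion_dyadicCell (n m : ℕ) : ⋃ z ∈ dyadicIndex n m, dyadicCell m z = icoCube n := by
  apply Set.Subset.antisymm
  · exact Set.iUnion₂_subset fun z hz => dyadicCell_subset_icoCube hz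
  · intro x hx
    obtain ⟨z, hz, hxz⟩ := exists_mem_dyadicCell hx m
    exact Set.mem_biUnion hz hxz

lemma eq_of_mem_dyadicCell {n m : ℕ} {z w : Fin n → ℕ} {x : Fin n → ℝ}
    (hz : x ∈ dyadicCell m z) (hw : x ∈ dyadicCell m w) : z = w := by
  ext i
  have h1 := mem_dyadicCell_iff.1 hz i
  have h2 := mem_dyadicCell_iff.1 hw i
  have h3 : (z i : ℝ) < w i + 1 := h1.1.trans_lt h2.2
  have h4 : (w i : ℝ) < z i + 1 := h2.1.trans_lt h1.2
  norm_cast at h3 h4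
  omega

lemma pairwiseDisjoint_dyadicCell (n m : ℕ) (s : Set (Fin n → ℕ)) :
    s.PairwiseDisjoint (dyadicCell (n := n) m) := by
  intro z _ w _ hzw
  exact Set.disjoint_left.2 fun x hx hx' => hzw (eq_of_mem_dyadicCell hx hx')

/-- A ball of radius `2^{-m}` meets at most `3^n` dyadic cells of side `2^{-m}`. -/
lemma exists_cells_of_ball {n : ℕ} (m : ℕ) (x : Fin n → ℝ) :
    ∃ s : Finset (Fin n → ℕ), s ⊆ dyadicIndex n m ∧ s.card ≤ 3 ^ n ∧
      ∀ z ∈ dyadicIndex n m, (dyadicCell m z ∩ Metric.ball x ((1 / 2 : ℝ) ^ m)).Nonempty →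
        z ∈ s := by
  have h2 : (0 : ℝ) < 2 ^ m := by positivity
  refine ⟨Fintype.piFinset fun i => (Finset.range (2 ^ m)).filter
    fun z : ℕ => ⌊2 ^ m * x i⌋ - 1 ≤ (z : ℤ) ∧ (z : ℤ) ≤ ⌊2 ^ m * x i⌋ + 1, ?_, ?_, ?_⟩
  · intro z hz
    rw [mem_dyadicIndex]
    intro i
    have := Fintype.mem_piFinset.1 hz i
    simpa using (Finset.mem_filter.1 this).1
  · rw [Fintype.card_piFinset]
    calc _ ≤ ∏ _i : Fin n, 3 := by
          apply Finset.prod_le_prod' fun i _ => ?_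
          have : ((Finset.Icc (⌊2 ^ m * x i⌋ - 1) (⌊2 ^ m * x i⌋ + 1)).card) = 3 := by
            rw [Int.card_Icc]; omega
          rw [← this]
          refine Finset.card_le_card_of_injOn (fun z : ℕ => (z : ℤ)) ?_ ?_
          · intro z hz
            have := (Finset.mem_filter.1 hz).2
            simpa using this
          · exact fun a _ b _ h => by simpa using h
      _ = 3 ^ n := by simp
  · rintro z hz ⟨y, hy, hyx⟩
    rw [Fintype.mem_piFinset]
    intro i
    have h := mem_dyadicCell_iff.1 hy i
    have hd : |y i - x i| < (1 / 2 : ℝ) ^ m :=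
      (dist_le_pi_dist y x i).trans_lt (Metric.mem_ball.1 hyx)
    have hd' : |2 ^ m * y i - 2 ^ m * x i| < 1 := by
      rw [← mul_sub, abs_mul, abs_of_pos h2]
      calc _ < 2 ^ m * (1 / 2 : ℝ) ^ m := by gcongr
        _ = 1 := by rw [← mul_pow]; norm_num
    rw [abs_lt] at hd'
    rw [Finset.mem_filter]
    refine ⟨by simpa using mem_dyadicIndex.1 hz i, ?_, ?_⟩
    · have : (⌊2 ^ m * x i⌋ : ℝ) < z i + 2 := by
        linarith [Int.floor_le (2 ^ m * x i), hd'.1, hd'.2, h.1, h.2]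
      have h' : ⌊2 ^ m * x i⌋ < (z i : ℤ) + 2 := by exact_mod_cast this
      omega
    · have : (z i : ℝ) < ⌊2 ^ m * x i⌋ + 2 := by
        linarith [Int.lt_floor_add_one (2 ^ m * x i), hd'.1, hd'.2, h.1, h.2]
      have h' : (z i : ℤ) < ⌊2 ^ m * x i⌋ + 2 := by exact_mod_cast this
      omega

/-- If `ν` is a finite measure on the unit cube of mass at least `1/2` with controlled dyadic
correlation sums, then every cover of its support by balls is expensive. -/
lemma exists_le_tsum_of_energy (n : ℕ) {t u : ℝ} (hut : u < t) :
    ∃ c : ENNReal, 0 < c ∧ c ≠ ⊤ ∧ ∀ (ν : Measure (Fin n → ℝ)) [IsFiniteMeasure ν] (K : Set (Fin n → ℝ)),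
      ν Kᶜ = 0 → ν (icoCube n)ᶜ = 0 → 1 / 2 ≤ ν.real Set.univ →
      (∀ m, ∑ z ∈ dyadicIndex n m, ν.real (dyadicCell m z) ^ 2 ≤ 2 * ((1 / 2 : ℝ) ^ m) ^ t) →
      ∀ (x : ℕ → Fin n → ℝ) (m : ℕ → ℕ), K ⊆ ⋃ i, Metric.ball (x i) ((1 / 2 : ℝ) ^ m i) →
        c ≤ ∑' i, ENNReal.ofReal (((1 / 2 : ℝ) ^ m i) ^ u) := by
  classical
  set ρ : ℝ := (1 / 2 : ℝ) ^ (t - u) with hρ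
  have hρ0 : 0 < ρ := by positivity
  have hρ1 : ρ < 1 := Real.rpow_lt_one (by norm_num) (by norm_num) (by linarith)
  set M : ℝ := 8 * (1 - ρ)⁻¹ with hM
  have hMpos : 0 < M := by
    have : 0 < 1 - ρ := by linarith
    positivity
  refine ⟨ENNReal.ofReal (1 / 4 / (3 ^ n * M)), ENNReal.ofReal_pos.2 (by positivity),
    ENNReal.ofReal_ne_top, ?_⟩
  intro ν _ K hK hcube hmass hen x m hcov
  set lam : ℕ → ℝ := fun k => M * ((1 / 2 : ℝ) ^ k) ^ u with hlam
  have hlampos : ∀ k, 0 < lam k := fun k => by positivity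
  set badI : ℕ → Finset (Fin n → ℕ) := fun k =>
    (dyadicIndex n k).filter fun z => lam k < ν.real (dyadicCell k z) with hbadI
  set bad : ℕ → Set (Fin n → ℝ) := fun k => ⋃ z ∈ badI k, dyadicCell k z with hbad
  have hbadm : ∀ k, ν (bad k) ≤ ENNReal.ofReal (1 / 4 * (1 - ρ) * ρ ^ k) := by
    intro k
    calc ν (bad k) ≤ ∑ z ∈ badI k, ν (dyadicCell k z) := measure_biUnion_finset_le _ _
      _ = ENNReal.ofReal (∑ z ∈ badI k, ν.real (dyadicCell k z)) := by
          rw [ENNReal.ofReal_sum_of_nonneg fun _ _ => measureReal_nonneg]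
          exact Finset.sum_congr rfl fun z _ => by rw [ofReal_measureReal]
      _ ≤ _ := by
          apply ENNReal.ofReal_le_ofReal
          calc ∑ z ∈ badI k, ν.real (dyadicCell k z)
              ≤ ∑ z ∈ badI k, ν.real (dyadicCell k z) ^ 2 / lam k := by
                refine Finset.sum_le_sum fun z hz => ?_
                have h := (Finset.mem_filter.1 hz).2
                rw [le_div_iff₀ (hlampos k), sq]
                exact mul_le_mul_of_nonneg_left h.le measureReal_nonneg
            _ = (∑ z ∈ badI k, ν.real (dyadicCell k z) ^ 2) / lam k := by rw [Finset.sum_div]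
            _ ≤ (2 * ((1 / 2 : ℝ) ^ k) ^ t) / lam k := by
                refine div_le_div_of_nonneg_right ?_ (hlampos k).le
                exact (Finset.sum_le_sum_of_subset_of_nonneg (Finset.filter_subset _ _)
                  fun _ _ _ => sq_nonneg _).trans (hen k)
            _ = 1 / 4 * (1 - ρ) * ρ ^ k := by
                have h1 : ρ ^ k = ((1 / 2 : ℝ) ^ k) ^ t / ((1 / 2 : ℝ) ^ k) ^ u := by
                  rw [← Real.rpow_sub (by positivity), hρ, ← Real.rpow_natCast, ← Real.rpow_mul
                    (by norm_num), ← Real.rpow_natCast, ← Real.rpow_mul (by norm_num), mul_comm]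
                rw [h1, hlam, hM]
                have h2 : ((1 / 2 : ℝ) ^ k) ^ u ≠ 0 := by positivity
                have h3 : 1 - ρ ≠ 0 := by linarith
                field_simp
                norm_num
  have hbadsum : ν (⋃ k, bad k) ≤ ENNReal.ofReal (1 / 4) := by
    calc ν (⋃ k, bad k) ≤ ∑' k, ν (bad k) := measure_iUnion_le _
      _ ≤ ∑' k, ENNReal.ofReal (1 / 4 * (1 - ρ) * ρ ^ k) := ENNReal.tsum_le_tsum hbadm
      _ = ENNReal.ofReal (1 / 4) := by
          rw [← ENNReal.ofReal_tsum_of_nonneg]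
          · rw [tsum_mul_left, tsum_geometric_of_lt_one hρ0.le hρ1]
            congr 1
            have h3 : 1 - ρ ≠ 0 := by linarith
            field_simp
          · intro k
            have : 0 < 1 - ρ := by linarith
            positivity
          · exact (summable_geometric_of_lt_one hρ0.le hρ1).mul_left _
  have hgood : ∀ i, ν ((Metric.ball (x i) ((1 / 2 : ℝ) ^ m i) ∩ icoCube n) \ bad (m i)) ≤
      ENNReal.ofReal (3 ^ n * lam (m i)) := by
    intro i
    obtain ⟨s, hs, hcard, hcell⟩ := exists_cells_of_ball (m i) (x i)
    set s' := s.filter fun z => ν.real (dyadicCell (m i) z) ≤ lam (m i)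
    calc _ ≤ ν (⋃ z ∈ s', dyadicCell (m i) z) := by
          refine measure_mono ?_
          rintro y ⟨⟨hyb, hyc⟩, hybad⟩
          obtain ⟨z, hz, hyz⟩ := exists_mem_dyadicCell hyc (m i)
          refine Set.mem_biUnion (Finset.mem_coe.2 (Finset.mem_filter.2
            ⟨hcell z hz ⟨y, hyz, hyb⟩, ?_⟩)) hyz
          by_contra! hc
          exact hybad (Set.mem_biUnion (Finset.mem_coe.2 (Finset.mem_filter.2 ⟨hz, hc⟩)) hyz)
      _ ≤ ∑ z ∈ s', ν (dyadicCell (m i) z) := measure_biUnion_finset_le _ _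
      _ ≤ ∑ z ∈ s', ENNReal.ofReal (lam (m i)) := by
          refine Finset.sum_le_sum fun z hz => ?_
          rw [← ofReal_measureReal]
          exact ENNReal.ofReal_le_ofReal (Finset.mem_filter.1 hz).2
      _ = s'.card * ENNReal.ofReal (lam (m i)) := by rw [Finset.sum_const, nsmul_eq_mul]
      _ ≤ (3 ^ n : ℕ) * ENNReal.ofReal (lam (m i)) := by
          gcongr
          exact (Finset.card_filter_le _ _).trans hcard
      _ = _ := by
          rw [ENNReal.ofReal_mul (p := (3 : ℝ) ^ n) (by positivity), ← ENNReal.ofReal_natCast]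
          push_cast
          rfl
  have hcover : (Set.univ : Set (Fin n → ℝ)) ⊆ Kᶜ ∪ ((icoCube n)ᶜ ∪ ((⋃ k, bad k) ∪
      ⋃ i, ((Metric.ball (x i) ((1 / 2 : ℝ) ^ m i) ∩ icoCube n) \ bad (m i)))) := by
    intro y _
    by_cases h1 : y ∈ K
    swap; · exact Or.inl h1
    by_cases h2 : y ∈ icoCube n
    swap; · exact Or.inr (Or.inl h2)
    refine Or.inr (Or.inr ?_)
    obtain ⟨i, hi⟩ := Set.mem_iUnion.1 (hcov h1)
    by_cases h3 : y ∈ bad (m i)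
    · exact Or.inl (Set.mem_iUnion.2 ⟨_, h3⟩)
    · exact Or.inr (Set.mem_iUnion.2 ⟨i, ⟨hi, h2⟩, h3⟩)
  have htot : ENNReal.ofReal (1 / 2) ≤ ENNReal.ofReal (1 / 4) +
      ∑' i, ENNReal.ofReal (3 ^ n * lam (m i)) := by
    calc ENNReal.ofReal (1 / 2) ≤ ν Set.univ := by
          rw [← ofReal_measureReal]; exact ENNReal.ofReal_le_ofReal hmass
      _ ≤ _ := measure_mono hcover
      _ ≤ ν Kᶜ + (ν (icoCube n)ᶜ + (ν (⋃ k, bad k) + _)) :=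
          (measure_union_le _ _).trans (add_le_add le_rfl ((measure_union_le _ _).trans
            (add_le_add le_rfl (measure_union_le _ _))))
      _ ≤ _ := by
          rw [hK, hcube, zero_add, zero_add]
          exact add_le_add hbadsum ((measure_iUnion_le _).trans (ENNReal.tsum_le_tsum hgood))
  have hsum : ∑' i, ENNReal.ofReal (3 ^ n * lam (m i)) =
      ENNReal.ofReal (3 ^ n * M) * ∑' i, ENNReal.ofReal (((1 / 2 : ℝ) ^ m i) ^ u) := by
    rw [← ENNReal.tsum_mul_left]
    refine tsum_congr fun i => ?_
    rw [← ENNReal.ofReal_mul (by positivity), hlam]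
    congr 1; ring
  rw [hsum] at htot
  have h4 : ENNReal.ofReal (1 / 4) ≤
      ENNReal.ofReal (3 ^ n * M) * ∑' i, ENNReal.ofReal (((1 / 2 : ℝ) ^ m i) ^ u) := by
    have : ENNReal.ofReal (1 / 2) = ENNReal.ofReal (1 / 4) + ENNReal.ofReal (1 / 4) := by
      rw [← ENNReal.ofReal_add (by norm_num) (by norm_num)]; norm_num
    rw [this] at htot
    exact (ENNReal.add_le_add_iff_left ENNReal.ofReal_ne_top).1 htot
  rw [ENNReal.ofReal_div_of_pos (by positivity)]
  exact ENNReal.div_le_of_le_mul' h4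

/-- Nested compact sets carrying measures with uniformly bounded dyadic correlation sums of
exponent `t` have an intersection of Hausdorff dimension at least `t`. -/
theorem le_dimH_iInter_of_energy {n : ℕ} {t : NNReal} (K : ℕ → Set (Fin n → ℝ))
    (hK : ∀ k, IsCompact (K k)) (hanti : Antitone K) (ν : ℕ → Measure (Fin n → ℝ))
    [∀ k, IsFiniteMeasure (ν k)] (hsupp : ∀ k, ν k (K k)ᶜ = 0)
    (hcube : ∀ k, ν k (icoCube n)ᶜ = 0) (hmass : ∀ k, 1 / 2 ≤ (ν k).real Set.univ)
    (hen : ∀ k m, ∑ z ∈ dyadicIndex n m, (ν k).real (dyadicCell m z) ^ 2 ≤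
      2 * ((1 / 2 : ℝ) ^ m) ^ (t : ℝ)) :
    (t : ENNReal) ≤ dimH (⋂ k, K k) := by
  by_contra! hlt
  obtain ⟨u, hu1, hu2⟩ := ENNReal.lt_iff_exists_nnreal_btwn.1 hlt
  have hut : (u : ℝ) < t := by exact_mod_cast hu2
  have hu0 : 0 < (u : ℝ) := by
    have : (0 : ENNReal) < u := bot_le.trans_lt hu1
    exact_mod_cast this
  have hzero := hausdorffMeasure_of_dimH_lt hu1
  obtain ⟨c, hc0, hct, hc⟩ := exists_le_tsum_of_energy n hut
  set c' : ENNReal := c / (2 * ENNReal.ofReal (2 ^ (u : ℝ))) with hc'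
  have hc'0 : c' / 2 ≠ 0 := by
    refine (ENNReal.div_pos (ENNReal.div_pos hc0.ne' ?_).ne' (by simp)).ne'
    exact ENNReal.mul_ne_top (by simp) ENNReal.ofReal_ne_top
  obtain ⟨ε, hε0, hε⟩ := ENNReal.exists_pos_sum_of_countable hc'0 ℕ
  rw [Measure.hausdorffMeasure_apply] at hzero
  have h1 := ENNReal.iSup_eq_zero.1 (ENNReal.iSup_eq_zero.1 hzero (1 / 2)) (by simp)
  have h2 : (⨅ (s : ℕ → Set (Fin n → ℝ)) (_ : ⋂ k, K k ⊆ ⋃ i, s i)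
      (_ : ∀ i, Metric.ediam (s i) ≤ 1 / 2), ∑' i, ⨆ (_ : (s i).Nonempty),
      Metric.ediam (s i) ^ (u : ℝ)) < c' / 2 := by
    rw [h1]; exact pos_iff_ne_zero.2 hc'0
  simp only [iInf_lt_iff] at h2
  obtain ⟨s, hs, hdiam, hsum⟩ := h2
  have key : ∀ i, ∃ (x : Fin n → ℝ) (m : ℕ), s i ⊆ Metric.ball x ((1 / 2 : ℝ) ^ m) ∧
      ENNReal.ofReal (((1 / 2 : ℝ) ^ m) ^ (u : ℝ)) ≤ ENNReal.ofReal (2 ^ (u : ℝ)) *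
        ((⨆ (_ : (s i).Nonempty), Metric.ediam (s i) ^ (u : ℝ)) + ε i) := by
    intro i
    have aux : ∀ d : ENNReal, d ≤ 1 / 2 → ∃ m : ℕ, d < ENNReal.ofReal ((1 / 2 : ℝ) ^ m) ∧
        ENNReal.ofReal (((1 / 2 : ℝ) ^ m) ^ (u : ℝ)) ≤ ENNReal.ofReal (2 ^ (u : ℝ)) *
        (d ^ (u : ℝ) + ε i) := by
      intro d hd
      have hd1 : d < 1 := hd.trans_lt (by simp)
      have hdt : d ≠ ⊤ := hd1.ne_top
      have hev : ∀ᶠ e in nhdsWithin d (Set.Ioi d), e ^ (u : ℝ) < d ^ (u : ℝ) + ε i := by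
        have hcont : Tendsto (fun e : ENNReal => e ^ (u : ℝ)) (nhds d) (nhds (d ^ (u : ℝ))) :=
          (ENNReal.continuous_rpow_const).tendsto d
        refine nhdsWithin_le_nhds (hcont.eventually (gt_mem_nhds ?_))
        refine ENNReal.lt_add_right (ENNReal.rpow_ne_top_of_nonneg hu0.le hdt) ?_
        exact_mod_cast (hε0 i).ne'
      have hev2 : ∀ᶠ e in nhdsWithin d (Set.Ioi d), e < 1 :=
        nhdsWithin_le_nhds (gt_mem_nhds hd1)
      have : (nhdsWithin d (Set.Ioi d)).NeBot := nhdsGT_neBot_of_exists_gt ⟨1, hd1⟩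
      obtain ⟨e, ⟨he1, he2⟩, he3⟩ := ((hev.and hev2).and self_mem_nhdsWithin).exists
      have het : e ≠ ⊤ := (he2.trans ENNReal.one_lt_top).ne
      lift e to NNReal using het
      have he0 : 0 < (e : ℝ) := by
        have : (0 : ENNReal) < e := bot_le.trans_lt he3
        exact_mod_cast this
      have he2' : (e : ℝ) ≤ 1 := by exact_mod_cast he2.le
      obtain ⟨m, hm1, hm2⟩ := exists_nat_pow_near_of_lt_one he0 he2'
        (by norm_num : (0 : ℝ) < 1 / 2) (by norm_num)
      refine ⟨m, ?_, ?_⟩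
      · refine (show d < (e : ENNReal) from he3).trans_le ?_
        rw [← ENNReal.ofReal_coe_nnreal]
        exact ENNReal.ofReal_le_ofReal hm2
      · calc ENNReal.ofReal (((1 / 2 : ℝ) ^ m) ^ (u : ℝ))
            ≤ ENNReal.ofReal ((2 * (e : ℝ)) ^ (u : ℝ)) := by
              apply ENNReal.ofReal_le_ofReal
              refine Real.rpow_le_rpow (by positivity) ?_ hu0.le
              rw [pow_succ] at hm1; linarith
          _ = ENNReal.ofReal (2 ^ (u : ℝ)) * (e : ENNReal) ^ (u : ℝ) := by
              rw [Real.mul_rpow (by norm_num) he0.le, ENNReal.ofReal_mul (by positivity),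
                ← ENNReal.ofReal_rpow_of_pos he0, ENNReal.ofReal_coe_nnreal]
          _ ≤ _ := by gcongr
    by_cases hne : (s i).Nonempty
    · obtain ⟨x, hx⟩ := hne
      obtain ⟨m, hm1, hm2⟩ := aux _ (hdiam i)
      refine ⟨x, m, fun y hy => ?_, ?_⟩
      · have h := (Metric.edist_le_ediam_of_mem hy hx).trans_lt hm1
        rw [edist_dist] at h
        exact Metric.mem_ball.2 ((ENNReal.ofReal_lt_ofReal_iff (by positivity)).1 h)
      · rw [ciSup_pos ⟨x, hx⟩]
        exact hm2
    · obtain ⟨m, hm1, hm2⟩ := aux 0 bot_le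
      refine ⟨0, m, ?_, ?_⟩
      · rw [Set.not_nonempty_iff_eq_empty.1 hne]; exact Set.empty_subset _
      · rw [ENNReal.zero_rpow_of_pos hu0] at hm2
        refine hm2.trans ?_
        gcongr
        exact bot_le
  choose x m hball hbound using key
  obtain ⟨k, hk⟩ := exists_subset_nhds_of_isCompact (V := K) (hanti.directed_ge) hK
    (U := ⋃ i, Metric.ball (x i) ((1 / 2 : ℝ) ^ m i)) (by
      intro y hy
      refine (isOpen_iUnion fun i => Metric.isOpen_ball).mem_nhds ?_
      obtain ⟨i, hi⟩ := Set.mem_iUnion.1 (hs hy)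
      exact Set.mem_iUnion.2 ⟨i, hball i hi⟩)
  have h5 := hc (ν k) (K k) (hsupp k) (hcube k) (hmass k) (hen k) x m hk
  have h2u : ENNReal.ofReal (2 ^ (u : ℝ)) ≠ 0 := (ENNReal.ofReal_pos.2 (by positivity)).ne'
  have h6 : ∑' i, ENNReal.ofReal (((1 / 2 : ℝ) ^ m i) ^ (u : ℝ)) ≤ c / 2 := by
    calc _ ≤ _ := ENNReal.tsum_le_tsum hbound
      _ = ENNReal.ofReal (2 ^ (u : ℝ)) * (_ + _) := by
          rw [ENNReal.tsum_mul_left, ENNReal.tsum_add]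
      _ ≤ ENNReal.ofReal (2 ^ (u : ℝ)) * (c' / 2 + c' / 2) := by gcongr
      _ = ENNReal.ofReal (2 ^ (u : ℝ)) * ((c / 2) / ENNReal.ofReal (2 ^ (u : ℝ))) := by
          rw [ENNReal.add_halves, hc', ENNReal.div_eq_inv_mul, ENNReal.mul_inv (by simp) (by simp),
            ENNReal.div_eq_inv_mul, ENNReal.div_eq_inv_mul, mul_comm (2 : ENNReal)⁻¹, mul_assoc]
      _ = c / 2 := ENNReal.mul_div_cancel h2u ENNReal.ofReal_ne_top
  exact (h5.trans h6).not_gt (ENNReal.half_lt_self hc0.ne' hct)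

/-! ### Products of densities that equidistribute at dyadic scales -/

lemma volumeReal_dyadicCell {n : ℕ} (m : ℕ) (z : Fin n → ℕ) :
    (volume : Measure (Fin n → ℝ)).real (dyadicCell m z) = ((1 / 2 : ℝ) ^ m) ^ n := by
  rw [measureReal_def, dyadicCell, Real.volume_pi_Ico, ← ENNReal.ofReal_prod_of_nonneg]
  · have h : ∀ i, ((z i : ℝ) + 1) / 2 ^ m - z i / 2 ^ m = (1 / 2 : ℝ) ^ m := by
      intro i; rw [one_div_pow]; ring
    simp only [h, Finset.prod_const, Finset.card_univ, Fintype.card_fin]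
    exact ENNReal.toReal_ofReal (by positivity)
  · intro i _
    rw [← sub_div]
    exact div_nonneg (by linarith) (by positivity)

lemma icoCube_subset_Icc (n : ℕ) : icoCube n ⊆ Set.Icc 0 1 := fun _ hx =>
  ⟨fun i => (hx i trivial).1, fun i => (hx i trivial).2.le⟩

lemma Continuous.integrableOn_icoCube {n : ℕ} {f : (Fin n → ℝ) → ℝ} (hf : Continuous f) :
    IntegrableOn f (icoCube n) :=
  (hf.continuousOn.integrableOn_compact isCompact_Icc).mono_set (icoCube_subset_Icc n)

lemma Continuous.integrableOn_dyadicCell {n m : ℕ} {z : Fin n → ℕ} (hz : z ∈ dyadicIndex n m)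
    {f : (Fin n → ℝ) → ℝ} (hf : Continuous f) : IntegrableOn f (dyadicCell m z) :=
  hf.integrableOn_icoCube.mono_set (dyadicCell_subset_icoCube hz)

lemma integral_icoCube_eq_sum {n : ℕ} (m : ℕ) {f : (Fin n → ℝ) → ℝ} (hf : Continuous f) :
    ∫ x in icoCube n, f x = ∑ z ∈ dyadicIndex n m, ∫ x in dyadicCell m z, f x := by
  rw [← iUnion_dyadicCell n m]
  exact integral_biUnion_finset _ (fun _ _ => measurableSet_dyadicCell _ _)
    (pairwiseDisjoint_dyadicCell _ _ _) fun z hz => hf.integrableOn_dyadicCell hz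

/-- Dyadic cells are unions of finer dyadic cells. -/
lemma exists_subdivision {n m M : ℕ} (hmM : m ≤ M) {z : Fin n → ℕ} (hz : z ∈ dyadicIndex n m) :
    ∃ J ⊆ dyadicIndex n M, ⋃ w ∈ J, dyadicCell M w = dyadicCell m z := by
  classical
  refine ⟨(dyadicIndex n M).filter fun w => dyadicCell M w ⊆ dyadicCell m z,
    Finset.filter_subset _ _, Set.Subset.antisymm ?_ ?_⟩
  · exact Set.iUnion₂_subset fun w hw => (Finset.mem_filter.1 hw).2
  · intro x hx
    obtain ⟨w, hw, hxw⟩ := exists_mem_dyadicCell (dyadicCell_subset_icoCube hz hx) M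
    refine Set.mem_biUnion (Finset.mem_coe.2 (Finset.mem_filter.2 ⟨hw, fun y hy => ?_⟩)) hxw
    rw [mem_dyadicCell_iff] at *
    obtain ⟨d, rfl⟩ := Nat.exists_eq_add_of_le hmM
    intro i
    have hd : (0 : ℝ) < 2 ^ d := by positivity
    have h1 := hx i
    have h2 := hxw i
    have h3 := hy i
    rw [pow_add] at h2 h3
    have h4 : (z i : ℝ) * 2 ^ d < w i + 1 := by nlinarith [h1.1, h2.2]
    have h5 : (w i : ℝ) < (z i + 1) * 2 ^ d := by nlinarith [h1.2, h2.1]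
    have h4' : z i * 2 ^ d ≤ w i := by
      have : z i * 2 ^ d < w i + 1 := by exact_mod_cast h4
      omega
    have h5' : w i + 1 ≤ (z i + 1) * 2 ^ d := by
      have : w i < (z i + 1) * 2 ^ d := by exact_mod_cast h5
      omega
    have h6 : (z i : ℝ) * 2 ^ d ≤ w i := by exact_mod_cast h4'
    have h7 : (w i : ℝ) + 1 ≤ (z i + 1) * 2 ^ d := by exact_mod_cast h5'
    constructor
    · refine le_of_mul_le_mul_right ?_ hd
      nlinarith [h3.1]
    · refine lt_of_mul_lt_mul_right ?_ hd.le
      nlinarith [h3.2]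

lemma exists_osc_le {n : ℕ} {f : (Fin n → ℝ) → ℝ} (hf : Continuous f) (m : ℕ) {ε : ℝ}
    (hε : 0 < ε) : ∃ M ≥ m, ∀ w ∈ dyadicIndex n M, ∀ x ∈ dyadicCell M w, ∀ y ∈ dyadicCell M w,
      |f x - f y| ≤ ε := by
  have huc := (isCompact_Icc (a := (0 : Fin n → ℝ)) (b := 1)).uniformContinuousOn_of_continuous
    hf.continuousOn
  obtain ⟨δ, hδ, h⟩ := Metric.uniformContinuousOn_iff.1 huc ε hε
  obtain ⟨M, hM⟩ := exists_pow_lt_of_lt_one hδ (by norm_num : (1 / 2 : ℝ) < 1)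
  refine ⟨max m M, le_max_left _ _, fun w hw x hx y hy => ?_⟩
  have hsub := (dyadicCell_subset_icoCube hw).trans (icoCube_subset_Icc n)
  refine (h x (hsub hx) y (hsub hy) ?_).le
  refine (dist_pi_le_iff (r := (1 / 2 : ℝ) ^ max m M) (by positivity)).2 (fun i => ?_) |>.trans_lt
    ((pow_le_pow_of_le_one (by norm_num) (by norm_num) (le_max_right _ _)).trans_lt hM)
  have h1 := mem_dyadicCell_iff.1 hx i
  have h2 := mem_dyadicCell_iff.1 hy i
  have h3 : (0 : ℝ) < 2 ^ max m M := by positivity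
  rw [Real.dist_eq, one_div_pow, le_div_iff₀ h3, ← abs_of_pos h3, ← abs_mul, abs_le]
  constructor <;> nlinarith [h1.1, h1.2, h2.1, h2.2]

lemma abs_integral_mul_sub_sum_le {n m M : ℕ} {z : Fin n → ℕ} {J : Finset (Fin n → ℕ)}
    (hJ : J ⊆ dyadicIndex n M) (hJz : ⋃ w ∈ J, dyadicCell M w = dyadicCell m z)
    {f g : (Fin n → ℝ) → ℝ} (hf : Continuous f) (hg : Continuous g) (hg0 : 0 ≤ g) {ε : ℝ}
    (hosc : ∀ w ∈ dyadicIndex n M, ∀ x ∈ dyadicCell M w, ∀ y ∈ dyadicCell M w,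
      |f x - f y| ≤ ε) :
    |(∫ x in dyadicCell m z, f x * g x) -
      ∑ w ∈ J, f (fun i => w i / 2 ^ M) * ∫ x in dyadicCell M w, g x| ≤
      ε * ∫ x in dyadicCell m z, g x := by
  have hsplit : ∀ F : (Fin n → ℝ) → ℝ, Continuous F →
      ∫ x in dyadicCell m z, F x = ∑ w ∈ J, ∫ x in dyadicCell M w, F x := by
    intro F hF
    rw [← hJz]
    exact integral_biUnion_finset _ (fun _ _ => measurableSet_dyadicCell _ _)
      (pairwiseDisjoint_dyadicCell _ _ _) fun w hw => hF.integrableOn_dyadicCell (hJ hw)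
  rw [hsplit (fun x => f x * g x) (hf.mul hg), hsplit _ hg, ← Finset.sum_sub_distrib, Finset.mul_sum]
  refine (Finset.abs_sum_le_sum_abs _ _).trans (Finset.sum_le_sum fun w hw => ?_)
  have i1 : IntegrableOn (fun x => f x * g x) (dyadicCell M w) :=
    (hf.mul hg).integrableOn_dyadicCell (hJ hw)
  have i2 : IntegrableOn (fun x => f (fun i => (w i : ℝ) / 2 ^ M) * g x) (dyadicCell M w) :=
    (continuous_const.mul hg).integrableOn_dyadicCell (hJ hw)
  rw [← integral_const_mul, ← integral_const_mul, ← integral_sub i1 i2]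
  have hcorner : (fun i => (w i : ℝ) / 2 ^ M) ∈ dyadicCell M w := by
    refine mem_dyadicCell_iff.2 fun i => ?_
    rw [mul_div_cancel₀ _ (by positivity)]
    exact ⟨le_rfl, by linarith⟩
  rw [← Real.norm_eq_abs]
  refine norm_integral_le_of_norm_le ((continuous_const.mul hg).integrableOn_dyadicCell (hJ hw)) ?_
  filter_upwards [ae_restrict_mem (measurableSet_dyadicCell M w)] with x hx
  rw [← sub_mul, norm_mul, Real.norm_eq_abs, Real.norm_of_nonneg (hg0 x)]
  exact mul_le_mul_of_nonneg_right (hosc w (hJ hw) x hx _ hcorner) (hg0 x)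

lemma tendsto_integral_mul_of_dyadic {n : ℕ} {g : ℕ → (Fin n → ℝ) → ℝ}
    (hg : ∀ N, Continuous (g N)) (hg0 : ∀ N, 0 ≤ g N)
    (hlim : ∀ m, ∀ z ∈ dyadicIndex n m, Tendsto (fun N => ∫ x in dyadicCell m z, g N x) atTop
      (nhds (((1 / 2 : ℝ) ^ m) ^ n)))
    {f : (Fin n → ℝ) → ℝ} (hf : Continuous f) {m : ℕ} {z : Fin n → ℕ}
    (hz : z ∈ dyadicIndex n m) :
    Tendsto (fun N => ∫ x in dyadicCell m z, f x * g N x) atTop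
      (nhds (∫ x in dyadicCell m z, f x)) := by
  rw [Metric.tendsto_atTop']
  intro ε hε
  obtain ⟨M, hM, hosc⟩ := exists_osc_le hf m (by positivity : 0 < ε / 8)
  obtain ⟨J, hJ, hJz⟩ := exists_subdivision hM hz
  have hone : ∀ (k : ℕ) (w : Fin n → ℕ),
      ∫ _x in dyadicCell k w, (1 : ℝ) = ((1 / 2 : ℝ) ^ k) ^ n := by
    intro k w; rw [setIntegral_const, volumeReal_dyadicCell, smul_eq_mul, mul_one]
  have hle1 : ((1 / 2 : ℝ) ^ m) ^ n ≤ 1 :=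
    pow_le_one₀ (by positivity) (pow_le_one₀ (by norm_num) (by norm_num))
  have hsumlim : Tendsto (fun N => ∑ w ∈ J, f (fun i => w i / 2 ^ M) *
      ∫ x in dyadicCell M w, g N x) atTop
      (nhds (∑ w ∈ J, f (fun i => w i / 2 ^ M) * ∫ _x in dyadicCell M w, (1 : ℝ))) := by
    refine tendsto_finsetSum _ fun w hw => ?_
    rw [hone]
    exact (hlim M w (hJ hw)).const_mul _
  have hbase := abs_integral_mul_sub_sum_le hJ hJz hf (continuous_const (y := (1 : ℝ)))
    (fun _ => zero_le_one) hosc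
  simp only [mul_one] at hbase
  have hev1 := (hlim m z hz).eventually (gt_mem_nhds (by linarith : ((1 / 2 : ℝ) ^ m) ^ n < 2))
  have hev2 := Metric.tendsto_atTop'.1 hsumlim (ε / 8) (by positivity)
  obtain ⟨N1, hN1⟩ := eventually_atTop.1 hev1
  obtain ⟨N2, hN2⟩ := hev2
  refine ⟨max N1 N2, fun N hN => ?_⟩
  have hb := abs_integral_mul_sub_sum_le hJ hJz hf (hg N) (hg0 N) hosc
  have h1 := hN1 N ((le_max_left _ _).trans hN.le)
  have h2 := hN2 N ((le_max_right _ _).trans_lt hN)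
  rw [hone] at hbase
  rw [Real.dist_eq] at h2 ⊢
  rw [abs_lt] at h2 ⊢
  rw [abs_le] at hb hbase
  have h3 : ε / 8 * ∫ x in dyadicCell m z, g N x ≤ ε / 8 * 2 :=
    mul_le_mul_of_nonneg_left h1.le (by positivity)
  have h4 : ε / 8 * ((1 / 2 : ℝ) ^ m) ^ n ≤ ε / 8 * 1 :=
    mul_le_mul_of_nonneg_left hle1 (by positivity)
  constructor <;> linarith [hb.1, hb.2, hbase.1, hbase.2, h2.1, h2.2]

/-- Nonnegative continuous functions with mass more than `1/2` on the unit cube and dyadic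
correlation sums below `2 · 2^{-mt}`. -/
structure IsFrostmanDensity {n : ℕ} (t : ℝ) (f : (Fin n → ℝ) → ℝ) : Prop where
  continuous : Continuous f
  nonneg : 0 ≤ f
  half_lt : 1 / 2 < ∫ x in icoCube n, f x
  energy_lt : ∀ m, ∑ z ∈ dyadicIndex n m, (∫ x in dyadicCell m z, f x) ^ 2 <
    2 * ((1 / 2 : ℝ) ^ m) ^ t

lemma card_dyadicIndex (n m : ℕ) : (dyadicIndex n m).card = (2 ^ m) ^ n := by
  simp [dyadicIndex]

lemma isFrostmanDensity_one {n : ℕ} {t : ℝ} (ht : t ≤ n) :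
    IsFrostmanDensity t (fun _ : Fin n → ℝ => 1) where
  continuous := continuous_const
  nonneg := fun _ => zero_le_one
  half_lt := by
    rw [integral_icoCube_eq_sum 0 continuous_const]
    simp only [setIntegral_const, volumeReal_dyadicCell, smul_eq_mul, mul_one, Finset.sum_const,
      card_dyadicIndex]
    norm_num
  energy_lt := by
    intro m
    simp only [setIntegral_const, volumeReal_dyadicCell, smul_eq_mul, mul_one, Finset.sum_const,
      card_dyadicIndex, nsmul_eq_mul]
    have h0 : 0 < ((1 / 2 : ℝ) ^ m) := by positivity
    have h1 : ((1 / 2 : ℝ) ^ m) ≤ 1 := pow_le_one₀ (by norm_num) (by norm_num)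
    have h2 : ((1 / 2 : ℝ) ^ m) ^ n ≤ ((1 / 2 : ℝ) ^ m) ^ t := by
      rw [← Real.rpow_natCast _ n]
      exact Real.rpow_le_rpow_of_exponent_ge h0 h1 ht
    have h3 : (((2 ^ m) ^ n : ℕ) : ℝ) * (((1 / 2 : ℝ) ^ m) ^ n) ^ 2 = ((1 / 2 : ℝ) ^ m) ^ n := by
      push_cast
      rw [sq, ← mul_assoc, ← mul_pow, ← mul_pow (2 : ℝ)]
      norm_num
    rw [h3]
    have h4 : 0 < ((1 / 2 : ℝ) ^ m) ^ n := by positivity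
    linarith

lemma IsFrostmanDensity.eventually_mul {n : ℕ} {t s C : ℝ} (hts : t < s)
    {g : ℕ → (Fin n → ℝ) → ℝ} (hg : ∀ N, Continuous (g N)) (hg0 : ∀ N, 0 ≤ g N)
    (hlim : ∀ m, ∀ z ∈ dyadicIndex n m, Tendsto (fun N => ∫ x in dyadicCell m z, g N x) atTop
      (nhds (((1 / 2 : ℝ) ^ m) ^ n)))
    (hen : ∀ᶠ N in atTop, ∀ m, ∑ z ∈ dyadicIndex n m, (∫ x in dyadicCell m z, g N x) ^ 2 ≤
      C * ((1 / 2 : ℝ) ^ m) ^ s)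
    {f : (Fin n → ℝ) → ℝ} (hf : IsFrostmanDensity t f) :
    ∀ᶠ N in atTop, IsFrostmanDensity t (fun x => f x * g N x) := by
  have hfg := fun m z (hz : z ∈ dyadicIndex n m) =>
    tendsto_integral_mul_of_dyadic hg hg0 hlim hf.continuous hz
  obtain ⟨B, hB⟩ := (isCompact_Icc (a := (0 : Fin n → ℝ)) (b := 1)).exists_bound_of_continuousOn
    hf.continuous.continuousOn
  have hmass : ∀ᶠ N in atTop, 1 / 2 < ∫ x in icoCube n, f x * g N x := by
    have h : Tendsto (fun N => ∫ x in icoCube n, f x * g N x) atTop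
        (nhds (∫ x in icoCube n, f x)) := by
      rw [integral_icoCube_eq_sum 0 hf.continuous]
      have h0 : ∀ N, ∫ x in icoCube n, f x * g N x =
          ∑ z ∈ dyadicIndex n 0, ∫ x in dyadicCell 0 z, f x * g N x := fun N =>
        integral_icoCube_eq_sum 0 (hf.continuous.mul (hg N))
      simp_rw [h0]
      exact tendsto_finsetSum _ fun z hz => hfg 0 z hz
    exact h.eventually (lt_mem_nhds hf.half_lt)
  have hsmall : ∀ m, ∀ᶠ N in atTop, ∑ z ∈ dyadicIndex n m,
      (∫ x in dyadicCell m z, f x * g N x) ^ 2 < 2 * ((1 / 2 : ℝ) ^ m) ^ t := by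
    intro m
    have h : Tendsto (fun N => ∑ z ∈ dyadicIndex n m, (∫ x in dyadicCell m z, f x * g N x) ^ 2)
        atTop (nhds (∑ z ∈ dyadicIndex n m, (∫ x in dyadicCell m z, f x) ^ 2)) :=
      tendsto_finsetSum _ fun z hz => (hfg m z hz).pow 2
    exact h.eventually (gt_mem_nhds (hf.energy_lt m))
  have hscale : ∀ᶠ m : ℕ in atTop, B ^ 2 * (C * ((1 / 2 : ℝ) ^ m) ^ s) <
      2 * ((1 / 2 : ℝ) ^ m) ^ t := by
    have h : Tendsto (fun m : ℕ => B ^ 2 * C * ((1 / 2 : ℝ) ^ (s - t)) ^ m) atTop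
        (nhds (B ^ 2 * C * 0)) :=
      (tendsto_pow_atTop_nhds_zero_of_lt_one (by positivity)
        (Real.rpow_lt_one (by norm_num) (by norm_num) (by linarith))).const_mul _
    rw [mul_zero] at h
    filter_upwards [h.eventually (gt_mem_nhds (by norm_num : (0 : ℝ) < 2))] with m hm
    have h1 : ((1 / 2 : ℝ) ^ m) ^ s = ((1 / 2 : ℝ) ^ (s - t)) ^ m * ((1 / 2 : ℝ) ^ m) ^ t := by
      rw [← Real.rpow_natCast, ← Real.rpow_natCast, ← Real.rpow_mul (by norm_num),
        ← Real.rpow_mul (by norm_num), ← Real.rpow_mul (by norm_num),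
        ← Real.rpow_add (by norm_num)]
      congr 1; ring
    have h2 : 0 < ((1 / 2 : ℝ) ^ m) ^ t := by positivity
    rw [h1]
    nlinarith
  obtain ⟨m₀, hm₀⟩ := eventually_atTop.1 hscale
  have hsmall' := (Finset.eventually_all (Finset.range m₀)).2 fun m _ => hsmall m
  filter_upwards [hmass, hsmall', hen] with N h1 h2 h3
  refine ⟨hf.continuous.mul (hg N), fun x => mul_nonneg (hf.nonneg x) (hg0 N x), h1, fun m => ?_⟩
  rcases lt_or_ge m m₀ with hm | hm
  · exact h2 m (Finset.mem_range.2 hm)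
  · refine lt_of_le_of_lt ?_ (hm₀ m hm)
    calc ∑ z ∈ dyadicIndex n m, (∫ x in dyadicCell m z, f x * g N x) ^ 2
        ≤ ∑ z ∈ dyadicIndex n m, B ^ 2 * (∫ x in dyadicCell m z, g N x) ^ 2 := by
          refine Finset.sum_le_sum fun z hz => ?_
          rw [← mul_pow]
          refine pow_le_pow_left₀ (integral_nonneg fun x => mul_nonneg (hf.nonneg x) (hg0 N x)) ?_ 2
          rw [← integral_const_mul]
          refine setIntegral_mono_on ((hf.continuous.mul (hg N)).integrableOn_dyadicCell hz)
            ((continuous_const.mul (hg N)).integrableOn_dyadicCell hz)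
            (measurableSet_dyadicCell m z) fun x hx => ?_
          have := hB x (icoCube_subset_Icc n (dyadicCell_subset_icoCube hz hx))
          exact mul_le_mul_of_nonneg_right ((le_abs_self _).trans this) (hg0 N x)
      _ ≤ _ := by
          rw [← Finset.mul_sum]
          exact mul_le_mul_of_nonneg_left (h3 m) (sq_nonneg B)

lemma measureReal_withDensity_dyadicCell {n m : ℕ} {z : Fin n → ℕ} (hz : z ∈ dyadicIndex n m)
    {f : (Fin n → ℝ) → ℝ} (hf : Continuous f) (hf0 : 0 ≤ f) :
    ((volume.restrict (icoCube n)).withDensity fun x => ENNReal.ofReal (f x)).real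
      (dyadicCell m z) = ∫ x in dyadicCell m z, f x := by
  rw [measureReal_def, withDensity_apply _ (measurableSet_dyadicCell m z),
    Measure.restrict_restrict (measurableSet_dyadicCell m z),
    Set.inter_eq_left.2 (dyadicCell_subset_icoCube hz),
    integral_eq_lintegral_of_nonneg_ae (ae_of_all _ hf0)
      hf.aestronglyMeasurable.restrict]

/-- A limsup set supporting equidistributing densities with uniformly bounded correlation sums of
exponent `s` has Hausdorff dimension at least every `t < s`. -/
theorem le_dimH_limsup_of_energy {n : ℕ} {t : NNReal} {s C : ℝ} (hts : t < s) (htn : (t : ℝ) ≤ n)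
    {g : ℕ → (Fin n → ℝ) → ℝ} (hg : ∀ N, Continuous (g N)) (hg0 : ∀ N, 0 ≤ g N)
    (hlim : ∀ m, ∀ z ∈ dyadicIndex n m, Tendsto (fun N => ∫ x in dyadicCell m z, g N x) atTop
      (nhds (((1 / 2 : ℝ) ^ m) ^ n)))
    (hen : ∀ᶠ N in atTop, ∀ m, ∑ z ∈ dyadicIndex n m, (∫ x in dyadicCell m z, g N x) ^ 2 ≤
      C * ((1 / 2 : ℝ) ^ m) ^ s)
    {E : ℕ → Set (Fin n → ℝ)} (hE : ∀ N, IsClosed (E N)) (hgE : ∀ N x, g N x ≠ 0 → x ∈ E N) :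
    (t : ENNReal) ≤ dimH {x ∈ Set.Icc (0 : Fin n → ℝ) 1 | ∃ᶠ N in atTop, x ∈ E N} := by
  have hnext : ∀ (f : {f : (Fin n → ℝ) → ℝ // IsFrostmanDensity t f}) (k : ℕ),
      ∃ N ≥ k, IsFrostmanDensity t fun x => f.1 x * g N x := fun f k =>
    ((eventually_ge_atTop k).and (f.2.eventually_mul hts hg hg0 hlim hen)).exists
  choose next hnext1 hnext2 using hnext
  let F : ℕ → {f : (Fin n → ℝ) → ℝ // IsFrostmanDensity (t : ℝ) f} := fun k =>
    Nat.rec ⟨fun _ => 1, isFrostmanDensity_one htn⟩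
      (fun k f => ⟨fun x => f.1 x * g (next f k) x, hnext2 f k⟩) k
  have hFs : ∀ k x, (F (k + 1)).1 x = (F k).1 x * g (next (F k) k) x := fun _ _ => rfl
  let K : ℕ → Set (Fin n → ℝ) := fun k => Set.Icc 0 1 ∩ ⋂ i ∈ Finset.range k, E (next (F i) i)
  have hsupp : ∀ k x, (F k).1 x ≠ 0 → ∀ i < k, x ∈ E (next (F i) i) := by
    intro k
    induction k with
    | zero => intro x _ i hi; omega
    | succ k ih =>
      intro x hx i hi
      rw [hFs] at hx
      rcases Nat.lt_succ_iff_lt_or_eq.1 hi with h | rfl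
      · exact ih x (left_ne_zero_of_mul hx) i h
      · exact hgE _ _ (right_ne_zero_of_mul hx)
  let ν : ℕ → Measure (Fin n → ℝ) := fun k =>
    (volume.restrict (icoCube n)).withDensity fun x => ENNReal.ofReal ((F k).1 x)
  have hfin : ∀ k, IsFiniteMeasure (ν k) := fun k =>
    isFiniteMeasure_withDensity_ofReal (F k).2.continuous.integrableOn_icoCube.2
  have hmain := le_dimH_iInter_of_energy (t := t) K
    (fun k => isCompact_Icc.inter_right (isClosed_biInter fun i _ => hE _)) ?_ ν ?_ ?_ ?_ ?_
  · refine hmain.trans (dimH_mono fun x hx => ?_)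
    rw [Set.mem_iInter] at hx
    refine ⟨(hx 0).1, frequently_atTop.2 fun k => ⟨_, hnext1 (F k) k, ?_⟩⟩
    exact Set.mem_iInter₂.1 (hx (k + 1)).2 k (Finset.mem_range.2 (Nat.lt_succ_self k))
  · intro a b hab
    refine Set.inter_subset_inter_right _ (Set.biInter_subset_biInter_left ?_)
    intro i hi
    exact Finset.mem_range.2 ((Finset.mem_range.1 hi).trans_le hab)
  · intro k
    have hKm : MeasurableSet (K k) :=
      (isCompact_Icc.inter_right (isClosed_biInter fun i _ => hE _)).measurableSet
    rw [withDensity_apply _ hKm.compl, lintegral_eq_zero_iff' (by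
      exact ((F k).2.continuous.measurable.ennreal_ofReal).aemeasurable)]
    have hae : ∀ᵐ x ∂((volume.restrict (icoCube n)).restrict (K k)ᶜ), x ∈ icoCube n :=
      ae_restrict_of_ae (ae_restrict_mem (measurableSet_icoCube n))
    filter_upwards [ae_restrict_mem hKm.compl, hae] with x hx1 hx2
    have : (F k).1 x = 0 := by
      by_contra hc
      exact hx1 ⟨icoCube_subset_Icc n hx2,
        Set.mem_iInter₂.2 fun i hi => hsupp k x hc i (Finset.mem_range.1 hi)⟩
    simp [this]
  · intro k
    refine withDensity_absolutelyContinuous _ _ ?_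
    rw [Measure.restrict_apply (measurableSet_icoCube n).compl]
    simp
  · intro k
    have h := (F k).2.half_lt
    rw [measureReal_def, withDensity_apply _ MeasurableSet.univ, Measure.restrict_univ,
      ← integral_eq_lintegral_of_nonneg_ae (ae_of_all _ (F k).2.nonneg)
        (F k).2.continuous.aestronglyMeasurable.restrict]
    exact h.le
  · intro k m
    refine le_trans (le_of_eq ?_) ((F k).2.energy_lt m).le
    exact Finset.sum_congr rfl fun z hz => by
      rw [measureReal_withDensity_dyadicCell hz (F k).2.continuous (F k).2.nonneg]

/-- A continuous `1`-periodic probability density concentrated `δ`-close to the integers. -/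
structure IsBump (δ : ℝ) (G : ℝ → ℝ) : Prop where
  continuous : Continuous G
  periodic : Function.Periodic G 1
  nonneg : 0 ≤ G
  integral_eq_one : ∫ x in (0 : ℝ)..1, G x = 1
  le : ∀ x, G x ≤ 4 / δ
  norm_le : ∀ x, G x ≠ 0 → ‖(x : UnitAddCircle)‖ ≤ δ

lemma exists_isBump {δ : ℝ} (hδ : 0 < δ) (hδ1 : δ ≤ 1) : ∃ G, IsBump δ G := by
  let H : ℝ → ℝ := fun x => max 0 (1 - ‖(x : UnitAddCircle)‖ / δ)
  have hc : Continuous H := by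
    have : Continuous fun x : ℝ => (x : UnitAddCircle) := AddCircle.continuous_mk' 1
    exact continuous_const.max (continuous_const.sub (this.norm.div_const δ))
  have hp : Function.Periodic H 1 := by
    intro x
    have h : ((x + 1 : ℝ) : UnitAddCircle) = x := AddCircle.coe_add_period 1 x
    simp only [H, h]
  have h0 : 0 ≤ H := fun x => le_max_left _ _
  have h1 : ∀ x, H x ≤ 1 := fun x => max_le zero_le_one (by
    have : 0 ≤ ‖(x : UnitAddCircle)‖ / δ := by positivity
    linarith)
  have hI : δ / 4 ≤ ∫ x in (0 : ℝ)..1, H x := by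
    have e : ∫ x in (0 : ℝ)..1, H x = (∫ x in (0 : ℝ)..(δ / 2), H x) + ∫ x in (δ / 2)..1, H x :=
      (intervalIntegral.integral_add_adjacent_intervals (hc.intervalIntegrable _ _)
        (hc.intervalIntegrable _ _)).symm
    have e1 : 0 ≤ ∫ x in (δ / 2)..1, H x :=
      intervalIntegral.integral_nonneg (by linarith) fun x _ => h0 x
    have e2 : ∫ _x in (0 : ℝ)..(δ / 2), (1 / 2 : ℝ) ≤ ∫ x in (0 : ℝ)..(δ / 2), H x := by
      refine intervalIntegral.integral_mono_on (by linarith) (by simp)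
        (hc.intervalIntegrable _ _) fun x hx => le_max_of_le_right ?_
      have : ‖(x : UnitAddCircle)‖ ≤ δ / 2 := by
        rw [UnitAddCircle.norm_eq]
        refine (round_le x 0).trans ?_
        simpa [abs_of_nonneg hx.1] using hx.2
      have h3 : ‖(x : UnitAddCircle)‖ / δ ≤ 1 / 2 := by
        rw [div_le_iff₀ hδ]; linarith
      linarith
    rw [intervalIntegral.integral_const, smul_eq_mul] at e2
    linarith
  set I := ∫ x in (0 : ℝ)..1, H x
  have hIpos : 0 < I := by linarith
  refine ⟨fun x => H x / I, hc.div_const I, fun x => by simp only [hp x],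
    fun x => div_nonneg (h0 x) hIpos.le, ?_, fun x => ?_, fun x hx => ?_⟩
  · rw [intervalIntegral.integral_div, div_self hIpos.ne']
  · rw [div_le_div_iff₀ hIpos hδ]
    nlinarith [h1 x]
  · by_contra hlt
    push Not at hlt
    refine hx ?_
    have : H x = 0 := max_eq_left (by
      have : 1 ≤ ‖(x : UnitAddCircle)‖ / δ := by rw [le_div_iff₀ hδ]; linarith
      linarith)
    simp [this]

namespace IsBump

variable {δ : ℝ} {G : ℝ → ℝ}

lemma integral_sub_le_one (hG : IsBump δ G) {a b : ℝ} (hab : a ≤ b) :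
    |(∫ x in a..b, G x) - (b - a)| ≤ 1 := by
  have hk : ∀ (k : ℤ), ∫ x in a..(a + k), G x = k := by
    intro k
    have := hG.periodic.intervalIntegral_add_zsmul_eq k a
      (fun _ _ => hG.continuous.intervalIntegrable _ _)
    have h2 := hG.periodic.intervalIntegral_add_eq a 0
    simp only [zsmul_eq_mul, mul_one, zero_add] at this h2
    rw [this, h2, hG.integral_eq_one, mul_one]
  have hmono : ∀ c d e : ℝ, c ≤ d → d ≤ e → ∫ x in c..d, G x ≤ ∫ x in c..e, G x := by
    intro c d e _ hde
    rw [← intervalIntegral.integral_add_adjacent_intervals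
      (hG.continuous.intervalIntegrable c d) (hG.continuous.intervalIntegrable d e)]
    have := intervalIntegral.integral_nonneg (μ := volume) hde fun x _ => hG.nonneg x
    linarith
  have hf := Int.floor_le (b - a)
  have hf' := Int.lt_floor_add_one (b - a)
  have h0 : (0 : ℝ) ≤ ⌊b - a⌋ := by exact_mod_cast Int.floor_nonneg.2 (by linarith)
  have h1 := hmono a (a + ⌊b - a⌋) b (by linarith) (by linarith)
  have h2 := hmono a b (a + (⌊b - a⌋ + 1 : ℤ)) hab (by push_cast; linarith)
  rw [hk] at h1 h2
  push_cast at h2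
  rw [abs_le]
  constructor <;> linarith

lemma integral_comp_sub_le (hG : IsBump δ G) {q θ a b : ℝ} (hq : 0 < q) (hab : a ≤ b) :
    |(∫ x in a..b, G (q * x - θ)) - (b - a)| ≤ 1 / q := by
  rw [intervalIntegral.integral_comp_mul_sub _ hq.ne', smul_eq_mul]
  have h := hG.integral_sub_le_one (a := q * a - θ) (b := q * b - θ) (by nlinarith)
  have e : q⁻¹ * (∫ x in (q * a - θ)..(q * b - θ), G x) - (b - a) =
      ((∫ x in (q * a - θ)..(q * b - θ), G x) - ((q * b - θ) - (q * a - θ))) / q := by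
    field_simp
    ring
  rw [e, abs_div, abs_of_pos hq]
  gcongr

lemma integral_comp_nonneg (hG : IsBump δ G) (q θ : ℝ) {a b : ℝ} (hab : a ≤ b) :
    0 ≤ ∫ x in a..b, G (q * x - θ) :=
  intervalIntegral.integral_nonneg hab fun _ _ => hG.nonneg _

lemma integral_comp_le_div (hG : IsBump δ G) (q θ : ℝ) {a b : ℝ} (hab : a ≤ b) :
    ∫ x in a..b, G (q * x - θ) ≤ 4 / δ * (b - a) := by
  have hc : Continuous fun x => G (q * x - θ) := hG.continuous.comp (by fun_prop)
  refine (intervalIntegral.integral_mono_on hab (hc.intervalIntegrable _ _)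
    (intervalIntegrable_const (c := 4 / δ)) fun x _ => hG.le _).trans ?_
  rw [intervalIntegral.integral_const, smul_eq_mul, mul_comm]

lemma exists_int_of_integral_ne_zero (hG : IsBump δ G) {q θ a b : ℝ} (hq : 0 ≤ q) (hab : a ≤ b)
    (h : ∫ x in a..b, G (q * x - θ) ≠ 0) : ∃ p : ℤ, |q * a - θ - p| ≤ δ + q * (b - a) := by
  by_contra hcon
  push Not at hcon
  refine h ?_
  rw [intervalIntegral.integral_congr (g := fun _ => 0), intervalIntegral.integral_zero]
  intro x hx
  rw [uIcc_of_le hab] at hx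
  by_contra hne
  have h1 := hG.norm_le _ hne
  rw [UnitAddCircle.norm_eq] at h1
  have h2 := hcon (round (q * x - θ))
  rw [abs_le] at h1
  rw [lt_abs] at h2
  have h3 := mul_le_mul_of_nonneg_left hx.1 hq
  have h4 := mul_le_mul_of_nonneg_left hx.2 hq
  rcases h2 with h2 | h2 <;> nlinarith [h1.1, h1.2]

end IsBump

lemma card_le_of_spread {s : Finset ℤ} {d : ℕ} {L : ℝ} (hd : 0 < d) (hL : 0 ≤ L)
    (hdvd : ∀ x ∈ s, ∀ y ∈ s, (d : ℤ) ∣ x - y) (hspread : ∀ x ∈ s, ∀ y ∈ s, ((x - y : ℤ) : ℝ) ≤ L) :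
    (s.card : ℝ) ≤ L / d + 1 := by
  have hd' : (0 : ℝ) < d := by exact_mod_cast hd
  rcases s.eq_empty_or_nonempty with rfl | hs
  · simp only [Finset.card_empty, Nat.cast_zero]; positivity
  set x₀ := s.min' hs
  have hx₀ : x₀ ∈ s := s.min'_mem hs
  have hcard : s.card ≤ (Finset.Icc (0 : ℤ) ⌊L / d⌋).card := by
    refine Finset.card_le_card_of_injOn (fun x => (x - x₀) / d) ?_ ?_
    · intro x hx
      obtain ⟨c, hc⟩ := hdvd x hx x₀ hx₀
      have hle : x₀ ≤ x := s.min'_le x hx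
      have h2 := hspread x hx x₀ hx₀
      simp only [hc, Finset.coe_Icc, Set.mem_Icc]
      rw [Int.mul_ediv_cancel_left _ (by exact_mod_cast hd.ne')]
      constructor
      · have hdz : (0 : ℤ) < d := by exact_mod_cast hd
        have : 0 ≤ (d : ℤ) * c := by omega
        exact nonneg_of_mul_nonneg_right this hdz
      · rw [Int.le_floor, le_div_iff₀ hd']
        rw [hc] at h2
        push_cast at h2
        linarith
    · intro x hx y hy hxy
      have hx' := Int.ediv_mul_cancel (hdvd x hx x₀ hx₀)
      have hy' := Int.ediv_mul_cancel (hdvd y hy x₀ hx₀)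
      simp only at hxy
      rw [hxy] at hx'
      omega
  have h0 : 0 ≤ ⌊L / d⌋ := Int.floor_nonneg.2 (by positivity)
  rw [Int.card_Icc, sub_zero] at hcard
  have h1 : (s.card : ℤ) ≤ ⌊L / d⌋ + 1 := by omega
  have h2 : (s.card : ℝ) ≤ (⌊L / d⌋ : ℝ) + 1 := by exact_mod_cast h1
  linarith [Int.floor_le (L / d)]

lemma card_le_mul_card_image_real {α β : Type*} [DecidableEq β] (s : Finset α) (f : α → β) {B : ℝ}
    (hB : ∀ a ∈ s, ((s.filter fun x => f x = f a).card : ℝ) ≤ B) :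
    (s.card : ℝ) ≤ B * (s.image f).card := by
  rw [Finset.card_eq_sum_card_image f s, Nat.cast_sum, mul_comm, ← nsmul_eq_mul]
  refine Finset.sum_le_card_nsmul _ _ _ fun b hb => ?_
  obtain ⟨a, ha, rfl⟩ := Finset.mem_image.1 hb
  exact hB a ha

/-- Counting the simultaneous close returns to the integers of two arithmetic progressions. -/
lemma card_close_le {N q q' : ℕ} (hq : q ∈ Finset.Ioc N (2 * N)) (hq' : q' ∈ Finset.Ioc N (2 * N))
    {r M θ θ' : ℝ} (hr : 0 < r) (hM1 : M ≤ 1) (hrM : r * N ≤ M) {s : Finset ℤ}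
    (hs : ∀ z ∈ s, 0 ≤ z ∧ z * r ≤ 1)
    (hp : ∀ z ∈ s, ∃ p : ℤ, |q * (z * r) - θ - p| ≤ 3 * M)
    (hp' : ∀ z ∈ s, ∃ p : ℤ, |q' * (z * r) - θ' - p| ≤ 3 * M) :
    (s.card : ℝ) ≤ 56 * (M / r) * (24 * M + q.gcd q' / N) := by
  rw [Finset.mem_Ioc] at hq hq'
  have hN : 0 < N := by omega
  have hNr : (0 : ℝ) < N := by exact_mod_cast hN
  have hM : 0 < M := lt_of_lt_of_le (by positivity) hrM
  have hqN : (N : ℝ) ≤ q := by exact_mod_cast hq.1.le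
  have hqN' : (N : ℝ) ≤ q' := by exact_mod_cast hq'.1.le
  have hq2 : (q : ℝ) ≤ 2 * N := by exact_mod_cast hq.2
  have hq2' : (q' : ℝ) ≤ 2 * N := by exact_mod_cast hq'.2
  have hq1 : (1 : ℝ) ≤ q := by exact_mod_cast (by omega : 1 ≤ q)
  set g := q.gcd q' with hg
  have hgpos : 0 < g := Nat.gcd_pos_of_pos_left _ (by omega)
  have hgr : (1 : ℝ) ≤ g := by exact_mod_cast hgpos
  choose! p hp using hp
  choose! p' hp' using hp'
  obtain ⟨u, hu⟩ : g ∣ q := Nat.gcd_dvd_left q q'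
  obtain ⟨v, hv⟩ : g ∣ q' := Nat.gcd_dvd_right q q'
  have huv : Nat.Coprime u v := by
    have := Nat.coprime_div_gcd_div_gcd (m := q) (n := q') hgpos
    rw [← hg] at this
    rwa [hu, hv, Nat.mul_div_cancel_left _ hgpos, Nat.mul_div_cancel_left _ hgpos] at this
  have hupos : 0 < u := by
    rcases Nat.eq_zero_or_pos u with h | h
    · rw [h] at hu; omega
    · exact h
  have hur : (0 : ℝ) < u := by exact_mod_cast hupos
  have huq : (q : ℝ) = g * u := by exact_mod_cast hu
  -- the number of `z` attached to a given numerator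
  have h3 : ∀ t ⊆ s, ∀ a ∈ t, ((t.filter fun x => p x = p a).card : ℝ) ≤ 7 * M / (N * r) := by
    intro t hts a ha
    have hb := card_le_of_spread (s := t.filter fun x => p x = p a) (d := 1)
      (L := 6 * M / (q * r)) one_pos (by positivity) (by simp) (by
        intro x hx y hy
        rw [Finset.mem_filter] at hx hy
        have hx' := abs_le.1 (hp x (hts hx.1))
        have hy' := abs_le.1 (hp y (hts hy.1))
        rw [hx.2] at hx'
        rw [hy.2] at hy'
        rw [le_div_iff₀ (by positivity)]
        push_cast
        nlinarith [hx'.1, hx'.2, hy'.1, hy'.2])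
    have e1 : 6 * M / (q * r) ≤ 6 * M / (N * r) := by gcongr
    have e2 : 1 ≤ M / (N * r) := by rw [le_div_iff₀ (by positivity)]; linarith
    have e3 : 7 * M / (N * r) = 6 * M / (N * r) + M / (N * r) := by ring
    rw [Nat.cast_one, div_one] at hb
    linarith
  -- the number of numerators with a given determinant
  have h2 : ∀ a ∈ s, ((s.filter fun x => p x * q' - p' x * q = p a * q' - p' a * q).card : ℝ) ≤
      7 * M / (N * r) * (8 * g) := by
    intro a ha
    refine (card_le_mul_card_image_real _ p (h3 _ (Finset.filter_subset _ _))).trans ?_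
    refine mul_le_mul_of_nonneg_left ?_ (by positivity)
    refine (card_le_of_spread (d := u) (L := q + 6 * M) hupos (by positivity) ?_ ?_).trans ?_
    · intro x₀ hx₀ y₀ hy₀
      obtain ⟨x, hx, rfl⟩ := Finset.mem_image.1 hx₀
      obtain ⟨y, hy, rfl⟩ := Finset.mem_image.1 hy₀
      rw [Finset.mem_filter] at hx hy
      have e : (p x - p y) * q' = (p' x - p' y) * q := by linarith [hx.2, hy.2]
      have hgz : (g : ℤ) ≠ 0 := by exact_mod_cast hgpos.ne'
      have e' : (p x - p y) * v = (p' x - p' y) * u := by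
        apply mul_left_cancel₀ hgz
        have h1 : (q : ℤ) = g * u := by exact_mod_cast hu
        have h2 : (q' : ℤ) = g * v := by exact_mod_cast hv
        rw [h1, h2] at e
        linarith
      exact (Nat.isCoprime_iff_coprime.2 huv).dvd_of_dvd_mul_right ⟨p' x - p' y, by rw [e']; ring⟩
    · intro x₀ hx₀ y₀ hy₀
      obtain ⟨x, hx, rfl⟩ := Finset.mem_image.1 hx₀
      obtain ⟨y, hy, rfl⟩ := Finset.mem_image.1 hy₀
      rw [Finset.mem_filter] at hx hy
      have hx' := abs_le.1 (hp x hx.1)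
      have hy' := abs_le.1 (hp y hy.1)
      have hx1 := hs x hx.1
      have hy1 := hs y hy.1
      have hy0 : (0 : ℝ) ≤ y * r := mul_nonneg (by exact_mod_cast hy1.1) hr.le
      push_cast
      nlinarith [hx'.1, hx'.2, hy'.1, hy'.2, hx1.2]
    · have e1 : (q + 6 * M) / u ≤ 7 * g := by
        rw [div_le_iff₀ hur]
        nlinarith
      linarith
  have h1 : ((s.image fun x => p x * q' - p' x * q).card : ℝ) ≤ 24 * N * M / g + 1 := by
    refine card_le_of_spread (d := g) (L := 24 * N * M) hgpos (by positivity) ?_ ?_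
    · intro x₀ hx₀ y₀ hy₀
      obtain ⟨x, hx, rfl⟩ := Finset.mem_image.1 hx₀
      obtain ⟨y, hy, rfl⟩ := Finset.mem_image.1 hy₀
      rw [hu, hv]
      exact ⟨(p x * v - p' x * u) - (p y * v - p' y * u), by push_cast; ring⟩
    · have key : ∀ x ∈ s, |(p x * q' - p' x * q : ℝ) - (θ' * q - θ * q')| ≤ 12 * N * M := by
        intro x hx
        have e : (p x * q' - p' x * q : ℝ) - (θ' * q - θ * q') =
            (q' * (x * r) - θ' - p' x) * q - (q * (x * r) - θ - p x) * q' := by ring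
        rw [e]
        refine (abs_sub _ _).trans ?_
        rw [abs_mul, abs_mul, Nat.abs_cast, Nat.abs_cast]
        have a1 := mul_le_mul (hp' x hx) hq2 (by positivity) (by positivity)
        have a2 := mul_le_mul (hp x hx) hq2' (by positivity) (by positivity)
        linarith
      intro x₀ hx₀ y₀ hy₀
      obtain ⟨x, hx, rfl⟩ := Finset.mem_image.1 hx₀
      obtain ⟨y, hy, rfl⟩ := Finset.mem_image.1 hy₀
      have a1 := abs_le.1 (key x hx)
      have a2 := abs_le.1 (key y hy)
      push_cast
      linarith [a1.1, a1.2, a2.1, a2.2]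
  calc (s.card : ℝ) ≤ 7 * M / (N * r) * (8 * g) *
        (s.image fun x => p x * q' - p' x * q).card := card_le_mul_card_image_real _ _ h2
    _ ≤ 7 * M / (N * r) * (8 * g) * (24 * N * M / g + 1) := by gcongr
    _ = _ := by field_simp; ring

/-- The correlation sum of two one-dimensional bumps over the intervals of length `r`. -/
lemma IsBump.sum_mul_le {N q q' : ℕ} (hq : q ∈ Finset.Ioc N (2 * N))
    (hq' : q' ∈ Finset.Ioc N (2 * N)) {δ r θ θ' : ℝ} {G : ℝ → ℝ} (hG : IsBump δ G) (hδ : 0 < δ)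
    (hδ1 : δ ≤ 1) {Z : ℕ} (hr : 0 < r) (hZ : Z * r = 1) :
    ∑ z ∈ Finset.range Z, (∫ x in (z * r)..((z + 1) * r), G (q * x - θ)) *
      (∫ x in (z * r)..((z + 1) * r), G (q' * x - θ')) ≤
      21504 * r * (1 + q.gcd q' / (N * max (r * N) δ)) := by
  have hN : 0 < N := by rw [Finset.mem_Ioc] at hq; omega
  have hNr : (0 : ℝ) < N := by exact_mod_cast hN
  have hle : ∀ z : ℕ, (z : ℝ) * r ≤ (z + 1) * r := fun z => by nlinarith
  have h0 : ∀ (k : ℕ) (t : ℝ) (z : ℕ), 0 ≤ ∫ x in (z * r)..((z + 1) * r), G (k * x - t) :=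
    fun k t z => hG.integral_comp_nonneg _ _ (hle z)
  have hbound : ∀ k ∈ Finset.Ioc N (2 * N), ∀ (t : ℝ) (z : ℕ),
      ∫ x in (z * r)..((z + 1) * r), G (k * x - t) ≤ r + 1 / N := by
    intro k hk t z
    rw [Finset.mem_Ioc] at hk
    have hkN : (N : ℝ) ≤ k := by exact_mod_cast hk.1.le
    have h := (abs_le.1 (hG.integral_comp_sub_le (q := k) (θ := t) (by linarith) (hle z))).2
    have h2 : 1 / (k : ℝ) ≤ 1 / N := one_div_le_one_div_of_le hNr hkN
    linarith
  set M := max (r * N) δ with hMdef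
  have hM : 0 < M := lt_max_of_lt_right hδ
  rcases lt_or_ge 1 (r * N) with hrN | hrN
  · have h1 : 1 / (N : ℝ) ≤ r := by rw [div_le_iff₀ hNr]; linarith
    calc _ ≤ ∑ z ∈ Finset.range Z, (2 * r) * (2 * r) := by
          refine Finset.sum_le_sum fun z _ => mul_le_mul ?_ ?_ (h0 _ _ _) (by positivity)
          · linarith [hbound q hq θ z]
          · linarith [hbound q' hq' θ' z]
      _ = 4 * r * (Z * r) := by rw [Finset.sum_const, Finset.card_range, nsmul_eq_mul]; ring
      _ ≤ 21504 * r * 1 := by rw [hZ]; linarith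
      _ ≤ _ := by
        gcongr
        have : (0 : ℝ) ≤ q.gcd q' / (N * M) := by positivity
        linarith
  · have hM1 : M ≤ 1 := max_le hrN hδ1
    have hbound' : ∀ k ∈ Finset.Ioc N (2 * N), ∀ (t : ℝ) (z : ℕ),
        ∫ x in (z * r)..((z + 1) * r), G (k * x - t) ≤ 4 * r / M := by
      intro k hk t z
      rcases max_choice (r * N) δ with h | h
      · rw [hMdef, h, mul_comm 4 r, mul_div_mul_left _ _ hr.ne']
        refine (hbound k hk t z).trans ?_
        rw [← sub_nonneg]
        have : 4 / (N : ℝ) - (r + 1 / N) = (3 - r * N) / N := by field_simp; ring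
        rw [this]
        exact div_nonneg (by linarith) hNr.le
      · rw [hMdef, h]
        refine (hG.integral_comp_le_div k t (hle z)).trans (le_of_eq ?_)
        ring
    have hclose : ∀ k ∈ Finset.Ioc N (2 * N), ∀ (t : ℝ) (z : ℕ),
        ∫ x in (z * r)..((z + 1) * r), G (k * x - t) ≠ 0 →
        ∃ p : ℤ, |k * (z * r) - t - p| ≤ 3 * M := by
      intro k hk t z hne
      obtain ⟨p, hp⟩ := hG.exists_int_of_integral_ne_zero (by positivity) (hle z) hne
      refine ⟨p, hp.trans ?_⟩
      have hk2 : (k : ℝ) ≤ 2 * N := by exact_mod_cast (Finset.mem_Ioc.1 hk).2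
      have h1 : δ ≤ M := le_max_right _ _
      have h2 : r * N ≤ M := le_max_left _ _
      nlinarith
    classical
    set s : Finset ℕ := (Finset.range Z).filter fun z : ℕ =>
      ∫ x in (z * r)..((z + 1) * r), G (q * x - θ) ≠ 0 ∧
      ∫ x in (z * r)..((z + 1) * r), G (q' * x - θ') ≠ 0 with hsdef
    have hcard : (s.card : ℝ) ≤ 56 * (M / r) * (24 * M + q.gcd q' / N) := by
      have hinj : Function.Injective fun z : ℕ => (z : ℤ) := Nat.cast_injective
      have := card_close_le hq hq' (θ := θ) (θ' := θ') hr hM1 (le_max_left _ _)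
        (s := s.map ⟨_, hinj⟩) ?_ ?_ ?_
      · simpa using this
      all_goals
        intro z₀ hz₀
        obtain ⟨z, hz, rfl⟩ := Finset.mem_map.1 hz₀
        rw [hsdef, Finset.mem_filter, Finset.mem_range] at hz
      · refine ⟨by simp, ?_⟩
        rw [← hZ]
        have : (z : ℝ) ≤ Z := by exact_mod_cast hz.1.le
        simpa using mul_le_mul_of_nonneg_right this hr.le
      · simpa using hclose q hq θ z hz.2.1
      · simpa using hclose q' hq' θ' z hz.2.2
    calc _ = ∑ z ∈ s, (∫ x in (z * r)..((z + 1) * r), G (q * x - θ)) *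
          (∫ x in (z * r)..((z + 1) * r), G (q' * x - θ')) := by
          refine (Finset.sum_filter_of_ne fun z _ hz => ?_).symm
          exact ⟨left_ne_zero_of_mul hz, right_ne_zero_of_mul hz⟩
      _ ≤ ∑ z ∈ s, (4 * r / M) * (4 * r / M) :=
          Finset.sum_le_sum fun z _ =>
            mul_le_mul (hbound' q hq θ z) (hbound' q' hq' θ' z) (h0 _ _ _) (by positivity)
      _ = s.card * ((4 * r / M) * (4 * r / M)) := by rw [Finset.sum_const, nsmul_eq_mul]
      _ ≤ 56 * (M / r) * (24 * M + q.gcd q' / N) * ((4 * r / M) * (4 * r / M)) := by gcongr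
      _ = 21504 * r + 896 * r * (q.gcd q' / (N * M)) := by field_simp; ring
      _ ≤ _ := by
        have : (0 : ℝ) ≤ q.gcd q' / (N * M) := by positivity
        nlinarith [mul_nonneg hr.le this]

lemma sum_gcd_le (K : ℕ) :
    ∑ q ∈ Finset.Ioc 0 K, ∑ q' ∈ Finset.Ioc 0 K, (q.gcd q' : ℝ) ≤ K ^ 2 * (1 + Real.log K) := by
  have h1 : ∀ q ∈ Finset.Ioc 0 K, ∀ q' ∈ Finset.Ioc 0 K, (q.gcd q' : ℝ) ≤
      ∑ d ∈ Finset.Ioc 0 K, (d : ℝ) * ((if d ∣ q then 1 else 0) * (if d ∣ q' then 1 else 0)) := by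
    intro q hq q' hq'
    rw [Finset.mem_Ioc] at hq
    have hg : q.gcd q' ∈ Finset.Ioc 0 K := Finset.mem_Ioc.2
      ⟨Nat.gcd_pos_of_pos_left _ hq.1, (Nat.gcd_le_left _ hq.1).trans hq.2⟩
    refine le_trans ?_ (Finset.single_le_sum (fun d _ => ?_) hg)
    · rw [if_pos (Nat.gcd_dvd_left _ _), if_pos (Nat.gcd_dvd_right _ _)]; simp
    · split_ifs <;> simp
  have hcount : ∀ d ∈ Finset.Ioc 0 K,
      ∑ q ∈ Finset.Ioc 0 K, (if d ∣ q then (1 : ℝ) else 0) ≤ K / d := by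
    intro d _
    rw [Finset.sum_boole, Nat.Ioc_filter_dvd_card_eq_div]
    exact Nat.cast_div_le
  have hharm : ∑ d ∈ Finset.Ioc 0 K, ((d : ℝ))⁻¹ ≤ 1 + Real.log K := by
    refine le_trans (le_of_eq ?_) (harmonic_le_one_add_log K)
    have : Finset.Ioc 0 K = Finset.Icc 1 K := by ext; simp [Nat.succ_le_iff]
    simp_rw [this, harmonic_eq_sum_Icc, Rat.cast_sum, Rat.cast_inv, Rat.cast_natCast]
  calc _ ≤ ∑ q ∈ Finset.Ioc 0 K, ∑ q' ∈ Finset.Ioc 0 K, ∑ d ∈ Finset.Ioc 0 K,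
        (d : ℝ) * ((if d ∣ q then 1 else 0) * (if d ∣ q' then 1 else 0)) :=
        Finset.sum_le_sum fun q hq => Finset.sum_le_sum fun q' hq' => h1 q hq q' hq'
    _ = ∑ d ∈ Finset.Ioc 0 K, (d : ℝ) * ((∑ q ∈ Finset.Ioc 0 K, (if d ∣ q then (1 : ℝ) else 0)) *
        ∑ q' ∈ Finset.Ioc 0 K, (if d ∣ q' then (1 : ℝ) else 0)) := by
      simp_rw [Finset.sum_mul_sum, Finset.mul_sum]
      rw [Finset.sum_congr rfl fun q _ => Finset.sum_comm, Finset.sum_comm]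
    _ ≤ ∑ d ∈ Finset.Ioc 0 K, (K : ℝ) ^ 2 * (d : ℝ)⁻¹ := by
      refine Finset.sum_le_sum fun d hd => ?_
      have hd0 : (0 : ℝ) < d := by exact_mod_cast (Finset.mem_Ioc.1 hd).1
      have h0 : 0 ≤ ∑ q ∈ Finset.Ioc 0 K, (if d ∣ q then (1 : ℝ) else 0) :=
        Finset.sum_nonneg fun q _ => by split_ifs <;> simp
      calc _ ≤ (d : ℝ) * (K / d * (K / d)) := by
            gcongr <;> exact hcount d hd
        _ = _ := by field_simp
    _ ≤ _ := by
      rw [← Finset.mul_sum]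
      gcongr

lemma prod_one_add_mul_le {ι : Type*} (s : Finset ι) {y : ℝ} (hy : 0 ≤ y) (hy1 : y ≤ 1)
    {b : ι → ℝ} (hb : ∀ i ∈ s, 0 ≤ b i) :
    ∏ i ∈ s, (1 + y * b i) ≤ 1 + y * (∏ i ∈ s, (1 + b i) - 1) := by
  classical
  induction s using Finset.induction_on with
  | empty => simp
  | insert a s ha ih =>
    rw [Finset.prod_insert ha, Finset.prod_insert ha]
    have h1 := ih fun i hi => hb i (Finset.mem_insert_of_mem hi)
    have hba := hb a (Finset.mem_insert_self _ _)
    have h2 : 1 ≤ ∏ i ∈ s, (1 + b i) := Finset.one_le_prod fun i hi => by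
      linarith [hb i (Finset.mem_insert_of_mem hi)]
    have h3 := mul_le_mul_of_nonneg_left h1 (by positivity : 0 ≤ 1 + y * b a)
    refine h3.trans ?_
    have : 0 ≤ (1 - y) * (y * b a * (∏ i ∈ s, (1 + b i) - 1)) :=
      mul_nonneg (by linarith) (mul_nonneg (by positivity) (by linarith))
    nlinarith

lemma sum_sq_sum_prod_eq {n Z : ℕ} (Q : Finset ℕ) (a : ℕ → Fin n → ℕ → ℝ) :
    ∑ z ∈ Fintype.piFinset (fun _ : Fin n => Finset.range Z), (∑ q ∈ Q, ∏ i, a q i (z i)) ^ 2 =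
      ∑ q ∈ Q, ∑ q' ∈ Q, ∏ i, ∑ z ∈ Finset.range Z, a q i z * a q' i z := by
  simp_rw [Finset.prod_univ_sum, sq, Finset.sum_mul_sum, Finset.prod_mul_distrib]
  rw [Finset.sum_comm]
  exact Finset.sum_congr rfl fun q _ => Finset.sum_comm

open scoped Classical in
/-- A choice of `IsBump δ` function, zero if there is none. -/
noncomputable def bump (δ : ℝ) : ℝ → ℝ := if h : ∃ G, IsBump δ G then h.choose else 0

lemma isBump_bump {δ : ℝ} (hδ : 0 < δ) (hδ1 : δ ≤ 1) : IsBump δ (bump δ) := by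
  have h := exists_isBump hδ hδ1
  rw [bump, dif_pos h]
  exact h.choose_spec

lemma continuous_bump (δ : ℝ) : Continuous (bump δ) := by
  rw [bump]
  split_ifs with h
  · exact h.choose_spec.continuous
  · exact continuous_zero

lemma bump_nonneg (δ x : ℝ) : 0 ≤ bump δ x := by
  rw [bump]
  split_ifs with h
  · exact h.choose_spec.nonneg x
  · exact le_rfl

/-- The width `(2N)^{-τ}/4` used for denominators in `(N, 2N]`. -/
noncomputable def approxWidth (τ : ℝ) (N : ℕ) : ℝ := (2 * N : ℝ) ^ (-τ) / 4

lemma approxWidth_pos (τ : ℝ) {N : ℕ} (hN : 0 < N) : 0 < approxWidth τ N := by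
  have : (0 : ℝ) < N := by exact_mod_cast hN
  rw [approxWidth]; positivity

lemma approxWidth_le_one {τ : ℝ} (hτ : 0 ≤ τ) {N : ℕ} (hN : 0 < N) : approxWidth τ N ≤ 1 := by
  have h1 : (1 : ℝ) ≤ N := by exact_mod_cast hN
  have := Real.rpow_le_one_of_one_le_of_nonpos (by linarith : (1 : ℝ) ≤ 2 * N) (by linarith : -τ ≤ 0)
  rw [approxWidth]; linarith

/-- Average over `N < q ≤ 2N` of products of bumps around the points `(p + θ q) / q`. -/
noncomputable def approxDensity {n : ℕ} (τ : Fin n → ℝ) (θ : ℕ → Fin n → ℝ) (N : ℕ)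
    (x : Fin n → ℝ) : ℝ :=
  (∑ q ∈ Finset.Ioc N (2 * N), ∏ i, bump (approxWidth (τ i) N) (q * x i - θ q i)) / N

/-- The points that lie, for some `N < q ≤ 2N`, close to a point `(p + θ q) / q`. -/
def approxSet {n : ℕ} (τ : Fin n → ℝ) (θ : ℕ → Fin n → ℝ) (N : ℕ) : Set (Fin n → ℝ) :=
  ⋃ q ∈ Finset.Ioc N (2 * N),
    {x | ∀ i, ‖((q * x i - θ q i : ℝ) : UnitAddCircle)‖ ≤ approxWidth (τ i) N}

/-- The mass of a one-dimensional bump on the `z`-th interval of length `r`. -/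
noncomputable def bumpMass (δ q θ r : ℝ) (z : ℕ) : ℝ :=
  ∫ x in (z * r)..((z + 1) * r), bump δ (q * x - θ)

section approxDensity

variable {n : ℕ} {τ : Fin n → ℝ} {θ : ℕ → Fin n → ℝ}

lemma continuous_approxDensity (N : ℕ) : Continuous (approxDensity τ θ N) := by
  refine Continuous.div_const (continuous_finsetSum _ fun q _ => continuous_finsetProd _
    fun i _ => (continuous_bump _).comp ?_) _
  fun_prop

lemma approxDensity_nonneg (N : ℕ) : 0 ≤ approxDensity τ θ N := fun _ =>
  div_nonneg (Finset.sum_nonneg fun _ _ => Finset.prod_nonneg fun _ _ => bump_nonneg _ _)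
    (Nat.cast_nonneg _)

lemma isClosed_approxSet (N : ℕ) : IsClosed (approxSet τ θ N) := by
  refine (Finset.finite_toSet _).isClosed_biUnion fun q _ => ?_
  simp only [Set.ofPred_forall]
  refine isClosed_iInter fun i => isClosed_le ?_ continuous_const
  have h : Continuous fun x : ℝ => (x : UnitAddCircle) := AddCircle.continuous_mk' 1
  exact (h.comp (by fun_prop)).norm

lemma mem_approxSet_of_ne_zero (hτ : ∀ i, 0 < τ i) {N : ℕ} {x : Fin n → ℝ}
    (h : approxDensity τ θ N x ≠ 0) : x ∈ approxSet τ θ N := by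
  rw [approxDensity, div_ne_zero_iff] at h
  obtain ⟨q, hq, hne⟩ := Finset.exists_ne_zero_of_sum_ne_zero h.1
  have hN : 0 < N := Nat.pos_of_ne_zero (by simpa using h.2)
  refine Set.mem_biUnion hq fun i => ?_
  exact (isBump_bump (approxWidth_pos _ hN) (approxWidth_le_one (hτ i).le hN)).norm_le _
    (Finset.prod_ne_zero_iff.1 hne i (Finset.mem_univ i))

lemma setIntegral_prod_dyadicCell (m : ℕ) (z : Fin n → ℕ) (f : Fin n → ℝ → ℝ) :
    ∫ x in dyadicCell m z, ∏ i, f i (x i) =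
      ∏ i, ∫ x in (z i * (1 / 2 : ℝ) ^ m)..((z i + 1) * (1 / 2 : ℝ) ^ m), f i x := by
  rw [dyadicCell, volume_pi, Measure.restrict_pi_pi, integral_fintype_prod_eq_prod]
  refine Finset.prod_congr rfl fun i _ => ?_
  rw [intervalIntegral.integral_of_le (by gcongr; linarith), ← integral_Ico_eq_integral_Ioc,
    one_div_pow, mul_one_div, mul_one_div]

lemma integral_approxDensity_dyadicCell {N m : ℕ} {z : Fin n → ℕ} (hz : z ∈ dyadicIndex n m) :
    ∫ x in dyadicCell m z, approxDensity τ θ N x =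
      (∑ q ∈ Finset.Ioc N (2 * N),
        ∏ i, bumpMass (approxWidth (τ i) N) q (θ q i) ((1 / 2) ^ m) (z i)) / N := by
  simp only [approxDensity]
  rw [integral_div, integral_finsetSum]
  · congr 1
    exact Finset.sum_congr rfl fun q _ =>
      setIntegral_prod_dyadicCell m z fun i y => bump (approxWidth (τ i) N) (q * y - θ q i)
  · intro q _
    refine Continuous.integrableOn_dyadicCell hz (continuous_finsetProd _
      fun i _ => (continuous_bump _).comp ?_)
    fun_prop

lemma abs_bumpMass_sub_le {δ q t r : ℝ} {z : ℕ} (hδ : 0 < δ) (hδ1 : δ ≤ 1) (hq : 0 < q)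
    (hr : 0 ≤ r) : |bumpMass δ q t r z - r| ≤ 1 / q := by
  have := (isBump_bump hδ hδ1).integral_comp_sub_le (θ := t) hq
    (by nlinarith : (z : ℝ) * r ≤ (z + 1) * r)
  rwa [show ((z : ℝ) + 1) * r - z * r = r by ring] at this

lemma bumpMass_nonneg {δ q t r : ℝ} {z : ℕ} (hr : 0 ≤ r) : 0 ≤ bumpMass δ q t r z :=
  intervalIntegral.integral_nonneg (by nlinarith) fun _ _ => bump_nonneg _ _

lemma tendsto_integral_approxDensity (hτ : ∀ i, 0 < τ i) (m : ℕ) {z : Fin n → ℕ}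
    (hz : z ∈ dyadicIndex n m) :
    Tendsto (fun N => ∫ x in dyadicCell m z, approxDensity τ θ N x) atTop
      (nhds (((1 / 2 : ℝ) ^ m) ^ n)) := by
  set r : ℝ := (1 / 2) ^ m
  have hr : 0 < r := by positivity
  have hinv : Tendsto (fun N : ℕ => 1 / (N : ℝ)) atTop (nhds 0) := tendsto_one_div_atTop_nhds_zero_nat
  have hlo : Tendsto (fun N : ℕ => (r - 1 / (N : ℝ)) ^ n) atTop (nhds (r ^ n)) := by
    simpa using (hinv.const_sub r).pow n
  have hhi : Tendsto (fun N : ℕ => (r + 1 / (N : ℝ)) ^ n) atTop (nhds (r ^ n)) := by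
    simpa using (hinv.const_add r).pow n
  have hev : ∀ᶠ N : ℕ in atTop, 0 < N ∧ 1 / (N : ℝ) < r ∧ ∀ q ∈ Finset.Ioc N (2 * N), ∀ i,
      |bumpMass (approxWidth (τ i) N) q (θ q i) r (z i) - r| ≤ 1 / N := by
    filter_upwards [eventually_gt_atTop 0, hinv.eventually (gt_mem_nhds hr)] with N hN hNr
    refine ⟨hN, hNr, fun q hq i => ?_⟩
    have hN' : (0 : ℝ) < N := by exact_mod_cast hN
    have hqN : (N : ℝ) ≤ q := by exact_mod_cast (Finset.mem_Ioc.1 hq).1.le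
    exact (abs_bumpMass_sub_le (approxWidth_pos _ hN) (approxWidth_le_one (hτ i).le hN)
      (by linarith) hr.le).trans (one_div_le_one_div_of_le hN' hqN)
  refine tendsto_of_tendsto_of_tendsto_of_le_of_le' hlo hhi ?_ ?_
  · filter_upwards [hev] with N ⟨hN, hNr, h⟩
    have hN' : (0 : ℝ) < N := by exact_mod_cast hN
    rw [integral_approxDensity_dyadicCell hz, le_div_iff₀ hN']
    have : ∑ _q ∈ Finset.Ioc N (2 * N), (r - 1 / (N : ℝ)) ^ n = (r - 1 / (N : ℝ)) ^ n * N := by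
      rw [Finset.sum_const, Nat.card_Ioc, nsmul_eq_mul, two_mul, Nat.add_sub_cancel, mul_comm]
    rw [← this]
    refine Finset.sum_le_sum fun q hq => ?_
    have : (r - 1 / (N : ℝ)) ^ n = ∏ _i : Fin n, (r - 1 / (N : ℝ)) := by simp
    rw [this]
    exact Finset.prod_le_prod (fun _ _ => by linarith) fun i _ => by
      linarith [(abs_le.1 (h q hq i)).1]
  · filter_upwards [hev] with N ⟨hN, hNr, h⟩
    have hN' : (0 : ℝ) < N := by exact_mod_cast hN
    rw [integral_approxDensity_dyadicCell hz, div_le_iff₀ hN']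
    have : ∑ _q ∈ Finset.Ioc N (2 * N), (r + 1 / (N : ℝ)) ^ n = (r + 1 / (N : ℝ)) ^ n * N := by
      rw [Finset.sum_const, Nat.card_Ioc, nsmul_eq_mul, two_mul, Nat.add_sub_cancel, mul_comm]
    rw [← this]
    refine Finset.sum_le_sum fun q hq => ?_
    have : (r + 1 / (N : ℝ)) ^ n = ∏ _i : Fin n, (r + 1 / (N : ℝ)) := by simp
    rw [this]
    exact Finset.prod_le_prod (fun _ _ => bumpMass_nonneg hr.le) fun i _ => by
      linarith [(abs_le.1 (h q hq i)).2]

/-- The correlation sum in terms of the widths. -/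
lemma energy_approxDensity_le (hτ : ∀ i, 0 < τ i) {N : ℕ} (hN : 0 < N) (m : ℕ) :
    ∑ z ∈ dyadicIndex n m, (∫ x in dyadicCell m z, approxDensity τ θ N x) ^ 2 ≤
      (21504 * (1 / 2 : ℝ) ^ m) ^ n * (1 + 2 * (1 + Real.log (2 * N)) / N *
        ∏ i, (1 + 2 / max ((1 / 2 : ℝ) ^ m * N) (approxWidth (τ i) N))) := by
  set r : ℝ := (1 / 2) ^ m with hrdef
  have hr : 0 < r := by positivity
  have hN' : (0 : ℝ) < N := by exact_mod_cast hN
  set M : Fin n → ℝ := fun i => max (r * N) (approxWidth (τ i) N)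
  have hM : ∀ i, 0 < M i := fun i => lt_max_of_lt_left (by positivity)
  set P := ∏ i, (1 + 2 / M i)
  have hP : 0 ≤ P := Finset.prod_nonneg fun i _ => by have := hM i; positivity
  set a : ℕ → Fin n → ℕ → ℝ := fun q i z => bumpMass (approxWidth (τ i) N) q (θ q i) r z
  have hZ : ((2 ^ m : ℕ) : ℝ) * r = 1 := by
    rw [hrdef]; push_cast; rw [← mul_pow]; norm_num
  have hpair : ∀ q ∈ Finset.Ioc N (2 * N), ∀ q' ∈ Finset.Ioc N (2 * N),
      ∏ i, ∑ z ∈ Finset.range (2 ^ m), a q i z * a q' i z ≤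
        (21504 * r) ^ n * (1 + q.gcd q' / (2 * N) * P) := by
    intro q hq q' hq'
    have hgcd : (q.gcd q' : ℝ) ≤ 2 * N := by
      have : q.gcd q' ≤ 2 * N :=
        (Nat.gcd_le_left _ (Nat.zero_lt_of_lt (Finset.mem_Ioc.1 hq).1)).trans (Finset.mem_Ioc.1 hq).2
      exact_mod_cast this
    have hy1 : (q.gcd q' : ℝ) / (2 * N) ≤ 1 := by rw [div_le_one (by positivity)]; exact hgcd
    calc _ ≤ ∏ i, (21504 * r * (1 + q.gcd q' / (N * M i))) := by
          refine Finset.prod_le_prod (fun i _ => Finset.sum_nonneg fun z _ =>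
            mul_nonneg (bumpMass_nonneg hr.le) (bumpMass_nonneg hr.le)) fun i _ => ?_
          exact (isBump_bump (approxWidth_pos _ hN) (approxWidth_le_one (hτ i).le hN)).sum_mul_le
            hq hq' (approxWidth_pos _ hN) (approxWidth_le_one (hτ i).le hN) hr hZ
      _ = (21504 * r) ^ n * ∏ i, (1 + q.gcd q' / (2 * N) * (2 / M i)) := by
          rw [Finset.prod_mul_distrib, Finset.prod_const, Finset.card_univ, Fintype.card_fin]
          congr 1
          refine Finset.prod_congr rfl fun i _ => ?_
          have := (hM i).ne'
          field_simp
      _ ≤ (21504 * r) ^ n * (1 + q.gcd q' / (2 * N) * (P - 1)) := by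
          gcongr
          exact prod_one_add_mul_le _ (by positivity) hy1 fun i _ => by have := hM i; positivity
      _ ≤ _ := by
          gcongr
          linarith
  have hsumeq : ∑ z ∈ dyadicIndex n m, (∫ x in dyadicCell m z, approxDensity τ θ N x) ^ 2 =
      (∑ q ∈ Finset.Ioc N (2 * N), ∑ q' ∈ Finset.Ioc N (2 * N),
        ∏ i, ∑ z ∈ Finset.range (2 ^ m), a q i z * a q' i z) / N ^ 2 := by
    rw [← sum_sq_sum_prod_eq, Finset.sum_div]
    refine Finset.sum_congr rfl fun z hz => ?_
    rw [integral_approxDensity_dyadicCell hz, div_pow]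
  have hgcdsum : ∑ q ∈ Finset.Ioc N (2 * N), ∑ q' ∈ Finset.Ioc N (2 * N), (q.gcd q' : ℝ) ≤
      (2 * N) ^ 2 * (1 + Real.log (2 * N)) := by
    have h := sum_gcd_le (2 * N)
    push_cast at h
    refine le_trans ?_ h
    have hsub : Finset.Ioc N (2 * N) ⊆ Finset.Ioc 0 (2 * N) := Finset.Ioc_subset_Ioc_left (by omega)
    refine (Finset.sum_le_sum fun q _ => Finset.sum_le_sum_of_subset_of_nonneg hsub
      fun _ _ _ => Nat.cast_nonneg _).trans ?_
    exact Finset.sum_le_sum_of_subset_of_nonneg hsub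
      fun _ _ _ => Finset.sum_nonneg fun _ _ => Nat.cast_nonneg _
  rw [hsumeq, div_le_iff₀ (by positivity)]
  calc _ ≤ ∑ q ∈ Finset.Ioc N (2 * N), ∑ q' ∈ Finset.Ioc N (2 * N),
        (21504 * r) ^ n * (1 + q.gcd q' / (2 * N) * P) :=
        Finset.sum_le_sum fun q hq => Finset.sum_le_sum fun q' hq' => hpair q hq q' hq'
    _ = (21504 * r) ^ n * (N ^ 2 + (∑ q ∈ Finset.Ioc N (2 * N), ∑ q' ∈ Finset.Ioc N (2 * N),
        (q.gcd q' : ℝ)) * (P / (2 * N))) := by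
      simp_rw [← Finset.mul_sum, Finset.sum_add_distrib, Finset.sum_mul, Finset.sum_const,
        Nat.card_Ioc, two_mul, Nat.add_sub_cancel, nsmul_eq_mul, mul_one, sq, div_mul_eq_mul_div,
        mul_div_assoc]
    _ ≤ (21504 * r) ^ n * (N ^ 2 + ((2 * N) ^ 2 * (1 + Real.log (2 * N))) * (P / (2 * N))) := by
      gcongr
    _ = _ := by
      field_simp

end approxDensity

lemma energy_approxDensity_le_rpow {n : ℕ} {τ : Fin n → ℝ} {θ : ℕ → Fin n → ℝ}
    (hτ : ∀ i, 0 < τ i) {s ε : ℝ} (hε : 0 < ε) (hsn : s ≤ n)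
    (hs : ∀ α, 0 ≤ α → (s + ε) * (1 + α) ≤ n + 1 + ∑ i, max 0 (α - τ i)) :
    ∃ C, ∀ᶠ N : ℕ in atTop, ∀ m,
      ∑ z ∈ dyadicIndex n m, (∫ x in dyadicCell m z, approxDensity τ θ N x) ^ 2 ≤
        C * ((1 / 2 : ℝ) ^ m) ^ s := by
  set P₀ : ℝ := ∏ i, (12 * (2 : ℝ) ^ τ i)
  have hP₀ : 0 ≤ P₀ := Finset.prod_nonneg fun i _ => by positivity
  set C₁ : ℝ := 2 * (2 ^ ε * (1 + 1 / ε))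
  refine ⟨21504 ^ n * (1 + 4 * 3 ^ n + C₁ * P₀), ?_⟩
  filter_upwards [eventually_ge_atTop 2] with N hN m
  have hN1 : (1 : ℝ) < N := by exact_mod_cast hN
  have hN0 : (0 : ℝ) < N := by linarith
  refine (energy_approxDensity_le hτ (by omega) m).trans ?_
  set r : ℝ := (1 / 2) ^ m
  have hr : 0 < r := by positivity
  have hr1 : r ≤ 1 := pow_le_one₀ (by norm_num) (by norm_num)
  have hrn : r ^ n ≤ r ^ s := by
    rw [← Real.rpow_natCast]
    exact Real.rpow_le_rpow_of_exponent_ge hr hr1 hsn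
  have hC₁ : 0 ≤ C₁ := by positivity
  have hlog0 : 0 ≤ Real.log (2 * N) := Real.log_nonneg (by linarith)
  have hP0 : 0 ≤ ∏ i, (1 + 2 / max (r * N) (approxWidth (τ i) N)) :=
    Finset.prod_nonneg fun i _ => by
      have : 0 < max (r * N) (approxWidth (τ i) N) := lt_max_of_lt_left (by positivity)
      positivity
  have key : r ^ n * (2 * (1 + Real.log (2 * N)) / N *
      ∏ i, (1 + 2 / max (r * N) (approxWidth (τ i) N))) ≤ (4 * 3 ^ n + C₁ * P₀) * r ^ s := by
    rcases le_or_gt 1 (r * N) with hrN | hrN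
    · have h1 : 2 * (1 + Real.log (2 * N)) / N ≤ 4 := by
        rw [div_le_iff₀ hN0]
        have := Real.log_le_sub_one_of_pos (by linarith : (0 : ℝ) < 2 * N)
        linarith
      have h2 : ∏ i, (1 + 2 / max (r * N) (approxWidth (τ i) N)) ≤ 3 ^ n := by
        have h3 : (3 : ℝ) ^ n = ∏ _i : Fin n, 3 := by simp
        rw [h3]
        refine Finset.prod_le_prod (fun i _ => ?_) fun i _ => ?_
        · have : 0 < max (r * N) (approxWidth (τ i) N) := lt_max_of_lt_left (by positivity)
          positivity
        · have : 2 / max (r * N) (approxWidth (τ i) N) ≤ 2 :=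
            div_le_self (by norm_num) (hrN.trans (le_max_left _ _))
          linarith
      calc _ ≤ r ^ s * (4 * 3 ^ n) := by gcongr
        _ ≤ _ := by
          have : 0 ≤ C₁ * P₀ * r ^ s := by positivity
          linarith
    · set α : ℝ := -Real.log r / Real.log N - 1
      have hlogN : 0 < Real.log N := Real.log_pos hN1
      have hα : 0 ≤ α := by
        have h := Real.log_neg (by positivity) hrN
        rw [Real.log_mul hr.ne' hN0.ne'] at h
        rw [sub_nonneg, le_div_iff₀ hlogN]
        linarith
      have hrα : r = (N : ℝ) ^ (-(1 + α)) := by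
        rw [Real.rpow_def_of_pos hN0]
        have : Real.log N * -(1 + α) = Real.log r := by
          simp only [α]; field_simp; ring
        rw [this, Real.exp_log hr]
      have h1 : 2 * (1 + Real.log (2 * N)) / N ≤ C₁ * (N : ℝ) ^ (ε - 1) := by
        have e1 := Real.log_le_rpow_div (by linarith : (0 : ℝ) ≤ 2 * N) hε
        have e2 := Real.one_le_rpow (by linarith : (1 : ℝ) ≤ 2 * N) hε.le
        rw [Real.rpow_sub_one hN0.ne', ← mul_div_assoc, div_le_div_iff_of_pos_right hN0]
        have e3 : C₁ * (N : ℝ) ^ ε = 2 * ((2 * N : ℝ) ^ ε + (2 * N : ℝ) ^ ε / ε) := by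
          rw [Real.mul_rpow (by norm_num) hN0.le]
          simp only [C₁]; ring
        rw [e3]
        linarith
      have h2 : ∏ i, (1 + 2 / max (r * N) (approxWidth (τ i) N)) ≤
          P₀ * (N : ℝ) ^ (∑ i, min α (τ i)) := by
        rw [Real.rpow_sum_of_pos hN0, ← Finset.prod_mul_distrib]
        refine Finset.prod_le_prod (fun i _ => ?_) fun i _ => ?_
        · have : 0 < max (r * N) (approxWidth (τ i) N) := lt_max_of_lt_left (by positivity)
          positivity
        · have h2τ : (1 : ℝ) ≤ 2 ^ τ i := Real.one_le_rpow (by norm_num) (hτ i).le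
          set M := max (r * N) (approxWidth (τ i) N)
          have hM : 0 < M := lt_max_of_lt_left (by positivity)
          have hM1 : M ≤ 1 := max_le hrN.le (approxWidth_le_one (hτ i).le (by omega))
          have hlow : (N : ℝ) ^ (-min α (τ i)) / (4 * 2 ^ τ i) ≤ M := by
            rcases le_total α (τ i) with h | h
            · rw [min_eq_left h]
              refine le_trans ?_ (le_max_left _ _)
              have : r * N = (N : ℝ) ^ (-α) := by
                rw [hrα, ← Real.rpow_add_one hN0.ne']
                congr 1; ring
              rw [this]
              exact div_le_self (by positivity) (by linarith)
            · rw [min_eq_right h]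
              refine le_trans (le_of_eq ?_) (le_max_right _ _)
              rw [approxWidth, Real.mul_rpow (by norm_num) hN0.le, Real.rpow_neg zero_le_two]
              field_simp
          calc 1 + 2 / M ≤ 3 / M := by
                rw [← sub_nonneg]
                have : 3 / M - (1 + 2 / M) = (1 - M) / M := by field_simp; ring
                rw [this]
                exact div_nonneg (by linarith) hM.le
            _ ≤ 3 / ((N : ℝ) ^ (-min α (τ i)) / (4 * 2 ^ τ i)) := by gcongr
            _ = _ := by
              rw [Real.rpow_neg hN0.le]
              field_simp
              norm_num
      have h3 : r ^ n * ((N : ℝ) ^ (ε - 1) * (N : ℝ) ^ (∑ i, min α (τ i))) ≤ r ^ s := by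
        rw [← Real.rpow_natCast, hrα, ← Real.rpow_mul hN0.le, ← Real.rpow_mul hN0.le,
          ← Real.rpow_add hN0, ← Real.rpow_add hN0]
        refine Real.rpow_le_rpow_of_exponent_le hN1.le ?_
        have e := hs α hα
        have e2 : ∑ i, max 0 (α - τ i) = n * α - ∑ i, min α (τ i) := by
          have : ∀ i, max 0 (α - τ i) = α - min α (τ i) := fun i => by
            rcases le_total α (τ i) with h | h
            · rw [min_eq_left h, max_eq_left (by linarith), sub_self]
            · rw [min_eq_right h, max_eq_right (by linarith)]
          simp_rw [this, Finset.sum_sub_distrib]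
          simp
        rw [e2] at e
        nlinarith
      calc _ ≤ r ^ n * (C₁ * (N : ℝ) ^ (ε - 1) * (P₀ * (N : ℝ) ^ (∑ i, min α (τ i)))) := by
            gcongr
        _ = C₁ * P₀ * (r ^ n * ((N : ℝ) ^ (ε - 1) * (N : ℝ) ^ (∑ i, min α (τ i)))) := by ring
        _ ≤ C₁ * P₀ * r ^ s := by gcongr
        _ ≤ _ := by
          have : 0 ≤ 4 * 3 ^ n * r ^ s := by positivity
          linarith
  rw [mul_pow]
  calc _ = 21504 ^ n * (r ^ n + r ^ n * (2 * (1 + Real.log (2 * N)) / N *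
      ∏ i, (1 + 2 / max (r * N) (approxWidth (τ i) N)))) := by ring
    _ ≤ 21504 ^ n * (r ^ s + (4 * 3 ^ n + C₁ * P₀) * r ^ s) := by gcongr
    _ = _ := by ring

/-- The limsup set of simultaneous weighted approximations has dimension at least every exponent
that satisfies all the local counting constraints strictly. -/
theorem le_dimH_limsup_approxSet {n : ℕ} {τ : Fin n → ℝ} (θ : ℕ → Fin n → ℝ)
    (hτ : ∀ i, 0 < τ i) {t : NNReal} {u : ℝ} (htu : t < u) (hun : u ≤ n)
    (hu : ∀ α, 0 ≤ α → u * (1 + α) ≤ n + 1 + ∑ i, max 0 (α - τ i)) :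
    (t : ENNReal) ≤
      dimH {x ∈ Set.Icc (0 : Fin n → ℝ) 1 | ∃ᶠ N in atTop, x ∈ approxSet τ θ N} := by
  obtain ⟨C, hC⟩ := energy_approxDensity_le_rpow (θ := θ) hτ
    (s := (t + u) / 2) (ε := (u - t) / 2) (by linarith) (by linarith) fun α hα => by
      have : ((t : ℝ) + u) / 2 + (u - t) / 2 = u := by ring
      rw [this]
      exact hu α hα
  exact le_dimH_limsup_of_energy (by linarith) (by linarith) continuous_approxDensity
    approxDensity_nonneg (fun m z hz => tendsto_integral_approxDensity hτ m hz) hC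
    isClosed_approxSet fun N x h => mem_approxSet_of_ne_zero hτ h

lemma tauK_pos {n : ℕ} {τψ τφ : Fin n → ℝ} (hτψ : ∀ i, 0 < τψ i) (hτφ : ∀ i, 0 < τφ i)
    (j k : Fin n) : 0 < tauK τψ τφ j k := by
  rw [tauK]
  split_ifs
  · exact add_pos (hτψ j) (hτφ j)
  · exact hτψ k

lemma dimExpr_eq {n : ℕ} (τψ τφ : Fin n → ℝ) (j k : Fin n) :
    dimExpr n τψ τφ j k =
      (n + 1 + ∑ i, max 0 (tauK τψ τφ j k - tauK τψ τφ j i)) / (1 + tauK τψ τφ j k) := by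
  classical
  set T := tauK τψ τφ j k
  have h : ∑ i ∈ Finset.univ.erase j, max 0 (T - tauK τψ τφ j i) =
      ∑ i ∈ Finset.univ.filter fun i => i ≠ j ∧ τψ i < T, (T - τψ i) := by
    have e : (Finset.univ.filter fun i => i ≠ j ∧ τψ i < T) =
        (Finset.univ.erase j).filter fun i => τψ i < T := by
      ext i; simp
    rw [e, Finset.sum_filter]
    refine Finset.sum_congr rfl fun i hi => ?_
    rw [tauK, if_neg (Finset.ne_of_mem_erase hi)]
    split_ifs with h
    · exact max_eq_right (by linarith)
    · exact max_eq_left (by linarith)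
  rw [← Finset.add_sum_erase _ _ (Finset.mem_univ j), h, dimExpr]
  have hj : tauK τψ τφ j j = τψ j + τφ j := if_pos rfl
  rw [hj]
  congr 1
  rw [sub_sub]
  have : ∀ a b c : ℝ, a + b + c = a + (c + b) := fun a b c => by ring
  rw [this]

/-- Constraints at the breakpoints of a piecewise linear function imply the constraint
everywhere. -/
lemma le_of_breakpoints {n : ℕ} (hn : 0 < n) {τ : Fin n → ℝ} (hτ : ∀ i, 0 < τ i)
    (hsum : 1 ≤ ∑ i, τ i) {u : ℝ} (hu : 0 ≤ u)
    (h : ∀ k, u * (1 + τ k) ≤ n + 1 + ∑ i, max 0 (τ k - τ i)) :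
    u ≤ n ∧ ∀ α, 0 ≤ α → u * (1 + α) ≤ n + 1 + ∑ i, max 0 (α - τ i) := by
  classical
  have hne : (Finset.univ : Finset (Fin n)).Nonempty := ⟨⟨0, hn⟩, Finset.mem_univ _⟩
  have hun : u ≤ n := by
    obtain ⟨k, _, hk⟩ := Finset.exists_max_image Finset.univ τ hne
    have h1 : ∑ i, max 0 (τ k - τ i) = n * τ k - ∑ i, τ i := by
      rw [Finset.sum_congr rfl fun i _ => max_eq_right (sub_nonneg.2 (hk i (Finset.mem_univ i))),
        Finset.sum_sub_distrib]
      simp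
    have h2 := h k
    rw [h1] at h2
    have h3 : u * (1 + τ k) ≤ n * (1 + τ k) := by linarith
    exact le_of_mul_le_mul_right h3 (by linarith [hτ k])
  refine ⟨hun, fun α hα => ?_⟩
  set A := Finset.univ.filter fun i => τ i ≤ α with hA
  have hmem : ∀ i, i ∈ A ↔ τ i ≤ α := fun i => by simp [hA]
  have hcard : ∀ c : ℝ, ∑ i, (if i ∈ A then c else 0) = A.card * c := fun c => by
    rw [Finset.sum_ite_mem, Finset.univ_inter, Finset.sum_const, nsmul_eq_mul]
  rcases le_or_gt u A.card with hc | hc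
  · rcases A.eq_empty_or_nonempty with he | hAne
    · rw [he, Finset.card_empty, Nat.cast_zero] at hc
      have : u = 0 := le_antisymm hc hu
      rw [this, zero_mul]
      have : 0 ≤ ∑ i, max 0 (α - τ i) := Finset.sum_nonneg fun i _ => le_max_left _ _
      positivity
    · obtain ⟨k, hkA, hk⟩ := Finset.exists_max_image A τ hAne
      rw [hmem] at hkA
      have h1 : ∑ i, (max 0 (τ k - τ i) + if i ∈ A then α - τ k else 0) ≤
          ∑ i, max 0 (α - τ i) := by
        refine Finset.sum_le_sum fun i _ => ?_
        split_ifs with hi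
        · rw [max_eq_right (sub_nonneg.2 (hk i hi))]
          exact le_max_of_le_right (by linarith)
        · rw [hmem, not_le] at hi
          rw [max_eq_left (by linarith), add_zero]
          exact le_max_left _ _
      rw [Finset.sum_add_distrib, hcard] at h1
      nlinarith [h k]
  · by_cases hex : ∃ i, i ∉ A
    · obtain ⟨i₀, hi₀⟩ := hex
      obtain ⟨k, hkA, hk⟩ := Finset.exists_min_image Aᶜ τ ⟨i₀, Finset.mem_compl.2 hi₀⟩
      rw [Finset.mem_compl, hmem, not_le] at hkA
      have h1 : ∑ i, (max 0 (τ k - τ i) + if i ∈ A then α - τ k else 0) ≤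
          ∑ i, max 0 (α - τ i) := by
        refine Finset.sum_le_sum fun i _ => ?_
        split_ifs with hi
        · rw [hmem] at hi
          rw [max_eq_right (by linarith)]
          exact le_max_of_le_right (by linarith)
        · have := hk i (Finset.mem_compl.2 hi)
          rw [max_eq_left (by linarith), add_zero]
          exact le_max_left _ _
      rw [Finset.sum_add_distrib, hcard] at h1
      nlinarith [h k]
    · push Not at hex
      rw [Finset.eq_univ_iff_forall.2 hex, Finset.card_univ, Fintype.card_fin] at hc
      linarith

/-- Shifts that move the `j`-th coordinate to the middle of the spherical shell. -/
noncomputable def shellShift {n : ℕ} (τψ τφ : Fin n → ℝ) (j : Fin n) (q : ℕ) (i : Fin n) : ℝ :=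
  if i = j then (1 - (q : ℝ) ^ (-τφ j) / 2) * (q : ℝ) ^ (-τψ j) else 0

lemma approxSet_limsup_subset_Wweighted {n : ℕ} {τψ τφ : Fin n → ℝ} (hτψ : ∀ i, 0 < τψ i)
    (hτφ : ∀ i, 0 < τφ i) (j : Fin n) :
    {x ∈ Set.Icc (0 : Fin n → ℝ) 1 |
      ∃ᶠ N in atTop, x ∈ approxSet (tauK τψ τφ j) (shellShift τψ τφ j) N} ⊆
    Wweighted n (fun i q => (q : ℝ) ^ (-(τψ i))) (fun i q => (q : ℝ) ^ (-(τφ i))) := by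
  rintro x ⟨hx, hfr⟩
  refine ⟨fun i _ => ⟨hx.1 i, hx.2 i⟩, ?_⟩
  refine Set.Infinite.of_image Prod.snd (Set.infinite_of_forall_exists_gt fun B => ?_)
  obtain ⟨N, hNB, hxN⟩ := frequently_atTop.1 hfr B
  simp only [approxSet, Set.mem_iUnion, exists_prop] at hxN
  obtain ⟨q, hq, hxq⟩ := hxN
  rw [Finset.mem_Ioc] at hq
  have hq0 : 0 < q := by omega
  have hqr : (0 : ℝ) < q := by exact_mod_cast hq0
  have hq2 : (q : ℝ) ≤ 2 * N := by exact_mod_cast hq.2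
  have hpow : ∀ i, approxWidth (tauK τψ τφ j i) N ≤ (q : ℝ) ^ (-tauK τψ τφ j i) / 4 := by
    intro i
    rw [approxWidth]
    gcongr ?_ / 4
    exact Real.rpow_le_rpow_of_nonpos hqr hq2 (by linarith [tauK_pos hτψ hτφ j i])
  simp only [Set.mem_ofPred_eq, UnitAddCircle.norm_eq] at hxq
  have hscale : ∀ (i : Fin n) (p : ℤ), |x i - p / q| = |q * x i - p| / q := by
    intro i p
    rw [← abs_of_pos hqr, ← abs_div, abs_of_pos hqr]
    congr 1
    field_simp
  have hj := (hxq j).trans (hpow j)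
  set p : Fin n → ℤ := fun i => round (q * x i - shellShift τψ τφ j q i)
  set a := (q : ℝ) ^ (-τψ j) with ha
  set b := (q : ℝ) ^ (-τφ j) with hb
  have ha0 : 0 < a := by positivity
  have hb0 : 0 < b := by positivity
  have hb1 : b ≤ 1 := Real.rpow_le_one_of_one_le_of_nonpos (by exact_mod_cast hq0)
    (by linarith [hτφ j])
  have hab : (q : ℝ) ^ (-tauK τψ τφ j j) = a * b := by
    rw [tauK, if_pos rfl, neg_add, Real.rpow_add hqr]
  have hshift : shellShift τψ τφ j q j = (1 - b / 2) * a := by rw [shellShift, if_pos rfl]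
  rw [hab, show round (q * x j - shellShift τψ τφ j q j) = p j from rfl, hshift] at hj
  have hj' := abs_le.1 hj
  have hab0 : 0 < a * b := by positivity
  have hab1 : a * b ≤ a := mul_le_of_le_one_right ha0.le hb1
  refine ⟨q, ⟨(p, q), ⟨hq0, fun i => ?_, j, ?_⟩, rfl⟩, by omega⟩
  · simp only [hscale]
    gcongr ?_ / _
    by_cases hij : i = j
    · subst hij
      rw [abs_lt]
      constructor <;> nlinarith [hj'.1, hj'.2]
    · have h := (hxq i).trans (hpow i)
      have hs : shellShift τψ τφ j q i = 0 := by rw [shellShift, if_neg hij]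
      rw [show round (q * x i - shellShift τψ τφ j q i) = p i from rfl, hs, sub_zero, tauK,
        if_neg hij] at h
      have : (0 : ℝ) < (q : ℝ) ^ (-τψ i) := by positivity
      linarith
  · simp only [hscale, ← mul_div_assoc]
    gcongr ?_ / _
    refine lt_of_lt_of_le ?_ (le_abs_self _)
    nlinarith [hj'.1, hj'.2]

/-- The lower bound for the dimension contributed by the `j`-th coordinate. -/
lemma le_dimH_Wweighted {n : ℕ} (hn : 0 < n) {τψ τφ : Fin n → ℝ} (hτψ : ∀ i, 0 < τψ i)
    (hτφ : ∀ i, 0 < τφ i) (hsum : 1 ≤ ∑ i, τψ i) (j : Fin n) :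
    ENNReal.ofReal (⨅ k, dimExpr n τψ τφ j k) ≤
      dimH (Wweighted n (fun i q => (q : ℝ) ^ (-(τψ i))) (fun i q => (q : ℝ) ^ (-(τφ i)))) := by
  set D := ⨅ k, dimExpr n τψ τφ j k
  have hpos := tauK_pos hτψ hτφ j
  have hDk : ∀ k, D * (1 + tauK τψ τφ j k) ≤
      n + 1 + ∑ i, max 0 (tauK τψ τφ j k - tauK τψ τφ j i) := by
    intro k
    have h : D ≤ dimExpr n τψ τφ j k := ciInf_le (Set.finite_range _).bddBelow k
    rwa [dimExpr_eq, le_div_iff₀ (by linarith [hpos k])] at h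
  have hsum' : 1 ≤ ∑ i, tauK τψ τφ j i := by
    refine hsum.trans (Finset.sum_le_sum fun i _ => ?_)
    rw [tauK]
    split_ifs with h
    · rw [h]; linarith [hτφ j]
    · exact le_rfl
  refine ENNReal.le_of_forall_nnreal_lt fun t ht => ?_
  have htD : (t : ℝ) < D := by
    rwa [← ENNReal.ofReal_coe_nnreal, ENNReal.ofReal_lt_ofReal_iff_of_nonneg t.coe_nonneg] at ht
  obtain ⟨h1, h2⟩ := le_of_breakpoints hn hpos hsum' (t.2.trans htD.le) hDk
  exact (le_dimH_limsup_approxSet (shellShift τψ τφ j) hpos htD h1 h2).trans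
    (dimH_mono (approxSet_limsup_subset_Wweighted hτψ hτφ j))

/-- The Hausdorff–Cantelli lemma. -/
lemma hausdorffMeasure_limsup_eq_zero {X ι : Type*} [EMetricSpace X] [MeasurableSpace X]
    [BorelSpace X] {A : ℕ → Set X} {F : ℕ → Finset ι} {U : ℕ → ι → Set X} {ρ f : ℕ → ENNReal}
    {d : ℝ} (hd : 0 ≤ d) (hρ : Tendsto ρ atTop (nhds 0)) (hmono : ∀ N ≥ 1, ∀ q ≥ N, ρ q ≤ ρ N)
    (hA : ∀ q ≥ 1, A q ⊆ ⋃ e ∈ F q, U q e) (hU : ∀ q ≥ 1, ∀ e ∈ F q, Metric.ediam (U q e) ≤ ρ q)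
    (hf : ∀ q ≥ 1, (F q).card * ρ q ^ d ≤ f q) (hsum : ∑' q, f q ≠ ⊤) :
    Measure.hausdorffMeasure d {x | ∃ᶠ q in atTop, x ∈ A q} = 0 := by
  have h := Measure.hausdorffMeasure_le_liminf_tsum d {x | ∃ᶠ q in atTop, x ∈ A q} ρ hρ
    (ι := fun N => Σ q : ℕ, F (q + N)) (fun N e => U (e.1 + N) e.2) (by
      filter_upwards [eventually_ge_atTop 1] with N hN e
      exact (hU _ (by omega) _ e.2.2).trans (hmono N hN _ (by omega))) (by
      filter_upwards [eventually_ge_atTop 1] with N hN x hx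
      obtain ⟨q, hq, hxq⟩ := frequently_atTop.1 hx N
      have hxU := hA q (hN.trans hq) hxq
      simp only [mem_iUnion] at hxU ⊢
      obtain ⟨e, he, hxe⟩ := hxU
      obtain ⟨r, rfl⟩ := Nat.exists_eq_add_of_le' hq
      exact ⟨⟨r, ⟨e, he⟩⟩, hxe⟩)
  refine le_antisymm (h.trans ?_) bot_le
  have ht := ENNReal.tendsto_sum_nat_add f hsum
  rw [← ht.liminf_eq]
  refine liminf_le_liminf ?_
  filter_upwards [eventually_ge_atTop 1] with N hN
  refine (ENNReal.tsum_sigma fun (q : ℕ) (e : F (q + N)) =>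
    Metric.ediam (U (q + N) e) ^ d).trans_le ?_
  refine ENNReal.tsum_le_tsum fun q => ?_
  refine le_trans ?_ (hf (q + N) (by omega))
  rw [tsum_fintype]
  refine (Finset.sum_le_card_nsmul _ _ (ρ (q + N) ^ d) fun e _ =>
    ENNReal.rpow_le_rpow (hU _ (by omega) _ e.2) hd).trans ?_
  simp

lemma exists_nat_mem_Icc_of_mem_Icc {y c L h : ℝ} (hh : 0 < h) (hy : y ∈ Icc c (c + L)) :
    ∃ k < ⌊L / h⌋₊ + 1, y ∈ Icc (c + k * h) (c + k * h + h) := by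
  have h0 : 0 ≤ (y - c) / h := div_nonneg (by linarith [hy.1]) hh.le
  refine ⟨⌊(y - c) / h⌋₊, Nat.lt_succ_of_le (Nat.floor_le_floor ?_), ?_, ?_⟩
  · exact div_le_div_of_nonneg_right (by linarith [hy.2]) hh.le
  · have := (le_div_iff₀ hh).1 (Nat.floor_le h0)
    linarith
  · have := (div_lt_iff₀ hh).1 (Nat.lt_floor_add_one ((y - c) / h))
    linarith

/-- Upper bound for the dimension of a limsup set of boxes around rational points with
denominator `q` and side lengths `q ^ (-1 - τ i)`. -/
lemma dimH_limsup_box_le {n : ℕ} (τ : Fin n → ℝ) (c : ℕ → Fin n → Bool → ℝ) {β : ℝ} (hβ : 0 < β) :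
    dimH {x : Fin n → ℝ | ∃ᶠ q : ℕ in atTop, ∀ i, ∃ p ≤ q, ∃ σ,
      (q : ℝ) * x i - p ∈ Icc (c q i σ) (c q i σ + (q : ℝ) ^ (-τ i))} ≤
      ENNReal.ofReal ((n + 1 + ∑ i, max 0 (β - τ i)) / (1 + β)) := by
  classical
  set S := ∑ i, max 0 (β - τ i) with hS
  have hβ1 : 0 < 1 + β := by linarith
  refine le_of_forall_gt_imp_ge_of_dense fun s hs => ?_
  induction s with
  | top => exact le_top
  | coe s =>
  have hs' : (n + 1 + S) / (1 + β) < s := by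
    rwa [ENNReal.ofReal_lt_coe_iff (by positivity)] at hs
  rw [div_lt_iff₀ hβ1] at hs'
  refine dimH_le_of_hausdorffMeasure_ne_top ?_
  set h : ℕ → ℝ := fun q => (q : ℝ) ^ (-β)
  set K : ℕ → Fin n → ℕ := fun q i => ⌊(q : ℝ) ^ (-τ i) / h q⌋₊ + 1
  let F : ℕ → Finset (Fin n → (ℕ × Bool) × ℕ) := fun q =>
    Fintype.piFinset fun i => (Finset.range (q + 1) ×ˢ Finset.univ) ×ˢ Finset.range (K q i)
  let lo : ℕ → (Fin n → (ℕ × Bool) × ℕ) → Fin n → ℝ := fun q e i =>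
    ((e i).1.1 + (c q i (e i).1.2 + (e i).2 * h q)) / q
  refine ne_of_eq_of_ne (hausdorffMeasure_limsup_eq_zero (A := fun q => {x : Fin n → ℝ | ∀ i, ∃ p ≤ q, ∃ σ,
      (q : ℝ) * x i - p ∈ Icc (c q i σ) (c q i σ + (q : ℝ) ^ (-τ i))}) (F := F)
    (U := fun q e => Set.pi univ fun i => Icc (lo q e i) (lo q e i + (q : ℝ) ^ (-(1 + β))))
    (ρ := fun q => ENNReal.ofReal ((q : ℝ) ^ (-(1 + β))))
    (f := fun q => ENNReal.ofReal (8 ^ n * (q : ℝ) ^ (n + S - (1 + β) * s))) s.coe_nonneg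
    ?_ ?_ ?_ ?_ ?_ ?_) ENNReal.zero_ne_top
  · rw [← ENNReal.ofReal_zero]
    exact ENNReal.tendsto_ofReal
      ((tendsto_rpow_neg_atTop hβ1).comp tendsto_natCast_atTop_atTop)
  · intro N hN q hq
    exact ENNReal.ofReal_le_ofReal (Real.rpow_le_rpow_of_nonpos (by exact_mod_cast hN)
      (by exact_mod_cast hq) (by linarith))
  · intro q hq x hx
    have hq0 : (0 : ℝ) < q := by exact_mod_cast hq
    have hh : 0 < h q := Real.rpow_pos_of_pos hq0 _
    choose p hp σ hσ using hx
    choose k hk hkm using fun i => exists_nat_mem_Icc_of_mem_Icc hh (hσ i)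
    simp only [mem_iUnion]
    refine ⟨fun i => ((p i, σ i), k i), ?_, fun i _ => ⟨?_, ?_⟩⟩
    · simp only [F, Fintype.mem_piFinset, Finset.mem_product, Finset.mem_range, Finset.mem_univ,
        and_true]
      exact fun i => ⟨Nat.lt_succ_of_le (hp i), hk i⟩
    · rw [div_le_iff₀ hq0]
      linarith [(hkm i).1]
    · have e : (q : ℝ) ^ (-(1 + β)) = h q / q := by
        rw [neg_add, Real.rpow_add hq0, Real.rpow_neg_one]
        simp only [h]
        ring
      rw [e, ← add_div, le_div_iff₀ hq0]
      linarith [(hkm i).2]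
  · intro q hq e _
    refine Metric.ediam_pi_le_of_le fun i => ?_
    rw [Real.ediam_Icc]
    simp
  · intro q hq
    have hq1 : (1 : ℝ) ≤ q := by exact_mod_cast hq
    have hq0 : (0 : ℝ) < q := by linarith
    have hcard : ((F q).card : ℝ) ≤ 8 ^ n * (q : ℝ) ^ (n + S) := by
      have h1 : ∀ i, (((q : ℝ) + 1) * 2) * K q i ≤ 8 * (q * (q : ℝ) ^ max 0 (β - τ i)) := by
        intro i
        have hle : (K q i : ℝ) ≤ 2 * (q : ℝ) ^ max 0 (β - τ i) := by
          have e : (q : ℝ) ^ (-τ i) / h q = (q : ℝ) ^ (β - τ i) := by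
            rw [← Real.rpow_sub hq0]
            congr 1
            ring
          have a1 : ((⌊(q : ℝ) ^ (-τ i) / h q⌋₊ : ℕ) : ℝ) ≤ (q : ℝ) ^ (β - τ i) := by
            rw [e]
            exact Nat.floor_le (Real.rpow_nonneg hq0.le _)
          have a2 := Real.rpow_le_rpow_of_exponent_le hq1 (le_max_right 0 (β - τ i))
          have a3 := Real.one_le_rpow hq1 (le_max_left 0 (β - τ i))
          simp only [K]
          push_cast
          linarith
        calc (((q : ℝ) + 1) * 2) * K q i ≤ ((q + q) * 2) * (2 * (q : ℝ) ^ max 0 (β - τ i)) := by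
              gcongr
          _ = _ := by ring
      have h2 : ((F q).card : ℝ) = ∏ i, (((q : ℝ) + 1) * 2) * K q i := by
        simp [F, Fintype.card_piFinset, Finset.card_product]
      rw [h2]
      refine (Finset.prod_le_prod (fun i _ => by positivity) fun i _ => h1 i).trans_eq ?_
      rw [Finset.prod_mul_distrib, Finset.prod_mul_distrib, ← Real.rpow_sum_of_pos hq0,
        Finset.prod_const, Finset.prod_const, Finset.card_univ, Fintype.card_fin,
        Real.rpow_add hq0, Real.rpow_natCast]
    rw [ENNReal.ofReal_rpow_of_nonneg (Real.rpow_nonneg hq0.le _) s.coe_nonneg, ← Real.rpow_mul hq0.le,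
      ← ENNReal.ofReal_natCast, ← ENNReal.ofReal_mul (by positivity)]
    refine ENNReal.ofReal_le_ofReal ((mul_le_mul_of_nonneg_right hcard
      (Real.rpow_nonneg hq0.le _)).trans_eq ?_)
    rw [mul_assoc, ← Real.rpow_add hq0]
    congr 2
    ring
  · have hsm : Summable fun q : ℕ => (8 : ℝ) ^ n * (q : ℝ) ^ (n + S - (1 + β) * s) :=
      (Real.summable_nat_rpow.2 (by linarith)).mul_left _
    exact hsm.tsum_ofReal_ne_top

/-- A point satisfying the strict upper bound and the lower bound in the `j`-th direction lies in
one of finitely many boxes. -/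
lemma exists_mem_Icc_of_approx {n : ℕ} {τψ τφ : Fin n → ℝ} (hτψ : ∀ i, 0 < τψ i)
    (j : Fin n) {q : ℕ} (hq : 0 < q) {x : Fin n → ℝ} (hx : x ∈ unitCube n)
    {p : Fin n → ℤ} (h : ∀ i, |x i - (p i : ℝ) / q| < (q : ℝ) ^ (-τψ i) / q)
    (hj : (1 - (q : ℝ) ^ (-τφ j)) * ((q : ℝ) ^ (-τψ j) / q) < |x j - (p j : ℝ) / q|) (i : Fin n) :
    ∃ r ≤ q, ∃ σ : Bool, (q : ℝ) * x i - r ∈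
      Icc (bif σ then -(q : ℝ) ^ (-τψ i) else
          if i = j then (1 - (q : ℝ) ^ (-τφ j)) * (q : ℝ) ^ (-τψ j) else 0)
        ((bif σ then -(q : ℝ) ^ (-τψ i) else
          if i = j then (1 - (q : ℝ) ^ (-τφ j)) * (q : ℝ) ^ (-τψ j) else 0) +
            (q : ℝ) ^ (-tauK τψ τφ j i)) := by
  have hq1 : (1 : ℝ) ≤ q := by exact_mod_cast hq
  have hq0 : (0 : ℝ) < q := by linarith
  have habs : ∀ i, |x i - (p i : ℝ) / q| = |q * x i - p i| / q := fun i => by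
    rw [show x i - (p i : ℝ) / q = (q * x i - p i) / q by field_simp, abs_div, abs_of_pos hq0]
  have hi : |q * x i - p i| < (q : ℝ) ^ (-τψ i) := by
    have := h i
    rwa [habs, div_lt_div_iff_of_pos_right hq0] at this
  have hj' : (1 - (q : ℝ) ^ (-τφ j)) * (q : ℝ) ^ (-τψ j) < |q * x j - p j| := by
    rwa [habs, ← mul_div_assoc, div_lt_div_iff_of_pos_right hq0] at hj
  have ha1 : (q : ℝ) ^ (-τψ i) ≤ 1 :=
    Real.rpow_le_one_of_one_le_of_nonpos hq1 (by linarith [hτψ i])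
  have hxi := hx i (mem_univ i)
  rw [abs_lt] at hi
  have hp0 : 0 ≤ p i := by
    have : (-1 : ℝ) < p i := by nlinarith [hxi.1]
    have : (-1 : ℤ) < p i := by exact_mod_cast this
    omega
  have hpq : p i ≤ q := by
    have : (p i : ℝ) < q + 1 := by nlinarith [hxi.2]
    have : p i < q + 1 := by exact_mod_cast this
    omega
  obtain ⟨r, hr⟩ := Int.eq_ofNat_of_zero_le hp0
  have hrr : (p i : ℝ) = r := by rw [hr]; simp
  refine ⟨r, by omega, ?_⟩
  rw [← hrr]
  by_cases hij : i = j
  · subst hij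
    have hT : (q : ℝ) ^ (-tauK τψ τφ i i) = (q : ℝ) ^ (-τφ i) * (q : ℝ) ^ (-τψ i) := by
      rw [tauK, if_pos rfl, ← Real.rpow_add hq0]
      congr 1
      ring
    rw [hT]
    rcases le_total 0 (q * x i - p i) with h0 | h0
    · rw [abs_of_nonneg h0] at hj'
      refine ⟨false, ?_, ?_⟩ <;> simp only [cond_false, if_true] <;> linarith
    · rw [abs_of_nonpos h0] at hj'
      refine ⟨true, ?_, ?_⟩ <;> simp only [cond_true] <;> linarith
  · rw [tauK, if_neg hij, if_neg hij]
    rcases le_total 0 (q * x i - p i) with h0 | h0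
    · refine ⟨false, ?_, ?_⟩ <;> simp only [cond_false] <;> linarith
    · refine ⟨true, ?_, ?_⟩ <;> simp only [cond_true] <;> linarith

lemma Wweighted_subset_iUnion {n : ℕ} (Ψ Φ : Fin n → ℕ → ℝ) (hΨ : ∀ i, ∀ q ≥ 1, Ψ i q ≤ 1) :
    Wweighted n Ψ Φ ⊆ ⋃ j, {x ∈ unitCube n | ∃ᶠ q : ℕ in atTop, 0 < q ∧ ∃ p : Fin n → ℤ,
      (∀ i, |x i - (p i : ℝ) / q| < Ψ i q / q) ∧
      (1 - Φ j q) * (Ψ j q / q) < |x j - (p j : ℝ) / q|} := by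
  rintro x ⟨hx, hinf⟩
  by_contra hcon
  simp only [mem_iUnion, mem_ofPred_eq, not_exists, not_and, not_frequently] at hcon
  obtain ⟨Q, hQ⟩ := eventually_atTop.1 (eventually_all.2 fun j => hcon j hx)
  refine hinf (Set.Finite.subset
    ((Set.Finite.pi (fun _ => Set.finite_Icc (-1 : ℤ) (Q + 1)) :
      (Set.pi univ fun _ : Fin n => Icc (-1 : ℤ) (Q + 1)).Finite).prod (Set.finite_Iio Q)) ?_)
  rintro ⟨p, q⟩ ⟨hq, h, j, hj⟩
  have hqQ : q < Q := by
    by_contra hle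
    exact hQ q (not_lt.1 hle) j hq p h hj
  refine ⟨fun i _ => ?_, hqQ⟩
  have hq0 : (0 : ℝ) < q := by exact_mod_cast hq
  have h1 : |x i - (p i : ℝ) / q| < 1 / q :=
    (h i).trans_le (div_le_div_of_nonneg_right (hΨ i q hq) hq0.le)
  rw [show x i - (p i : ℝ) / q = (q * x i - p i) / q by field_simp, abs_div, abs_of_pos hq0,
    div_lt_div_iff_of_pos_right hq0, abs_lt] at h1
  have hxi := hx i (mem_univ i)
  have hqQ' : (q : ℝ) ≤ Q := by exact_mod_cast hqQ.le
  constructor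
  · have : (-1 : ℝ) ≤ p i := by nlinarith [hxi.1]
    exact_mod_cast this
  · have : (p i : ℝ) ≤ Q + 1 := by nlinarith [hxi.2]
    exact_mod_cast this

lemma dimH_Wweighted_le {n : ℕ} (hn : 0 < n) {τψ τφ : Fin n → ℝ} (hτψ : ∀ i, 0 < τψ i)
    (hτφ : ∀ i, 0 < τφ i) :
    dimH (Wweighted n (fun i q => (q : ℝ) ^ (-(τψ i))) (fun i q => (q : ℝ) ^ (-(τφ i)))) ≤
      ENNReal.ofReal (⨆ j, ⨅ k, dimExpr n τψ τφ j k) := by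
  have : Nonempty (Fin n) := ⟨⟨0, hn⟩⟩
  refine (dimH_mono (Wweighted_subset_iUnion _ _ fun i q hq => ?_)).trans ?_
  · exact Real.rpow_le_one_of_one_le_of_nonpos (by exact_mod_cast hq) (by linarith [hτψ i])
  rw [dimH_iUnion]
  refine iSup_le fun j => ?_
  obtain ⟨k, hk⟩ := exists_eq_ciInf_of_finite (f := fun k => dimExpr n τψ τφ j k)
  refine le_trans ?_ (ENNReal.ofReal_le_ofReal
    (le_ciSup (f := fun j => ⨅ k, dimExpr n τψ τφ j k) (Set.finite_range _).bddAbove j))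
  rw [← hk, dimExpr_eq]
  refine (dimH_mono ?_).trans (dimH_limsup_box_le (fun i => tauK τψ τφ j i)
    (fun q i σ => bif σ then -(q : ℝ) ^ (-τψ i) else
      if i = j then (1 - (q : ℝ) ^ (-τφ j)) * (q : ℝ) ^ (-τψ j) else 0)
    (tauK_pos hτψ hτφ j k))
  rintro x ⟨hx, hfr⟩
  exact hfr.mono fun q ⟨hq, p, h, hj⟩ => exists_mem_Icc_of_approx hτψ j hq hx h hj

theorem stmt2 (n : ℕ) (hn : 0 < n) (τψ τφ : Fin n → ℝ)
    (hτψ : ∀ i, 0 < τψ i) (hτφ : ∀ i, 0 < τφ i)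
    (hsum : 1 ≤ ∑ i, τψ i) :
    dimH (Wweighted n (fun i q => (q : ℝ) ^ (-(τψ i))) (fun i q => (q : ℝ) ^ (-(τφ i)))) =
      ENNReal.ofReal (⨆ j, ⨅ k, dimExpr n τψ τφ j k) := by
  have : Nonempty (Fin n) := ⟨⟨0, hn⟩⟩
  refine le_antisymm (dimH_Wweighted_le hn hτψ hτφ) ?_
  obtain ⟨j, hj⟩ := exists_eq_ciSup_of_finite (f := fun j => ⨅ k, dimExpr n τψ τφ j k)
  rw [← hj]
  exact le_dimH_Wweighted hn hτψ hτφ hsum j
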